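/- arXiv:2112.14353 — 4 statements merged into one kernel-verified Lean document; each statement's English description precedes it below -/
import Mathlib

section
/- Let Y = θ₀ + Z with Z ~ N(0, σ²Iₙ) in ℝⁿ, σ > 0, and let {H_s}_{s∈S} be a finite collection of matrices in ℝ^{n×n} with SURE(s, y) = ‖y − H_s y‖₂² + 2σ² tr(H_s) and risk R(s) = ‖(I − H_s)θ₀‖₂² + σ²‖H_s‖_F². Let ŝ : ℝⁿ → S be a measurable selection with SURE(ŝ(y), y) = min_{s∈S} SURE(s, y) for all y, let s₀ minimize R over S, and define the excess degrees of freedom edf = E[(1/σ²) (H_{ŝ(Y)} Y)ᵀ(Y − θ₀) − tr(H_{ŝ(Y)})]. Suppose r★ ≥ 1 satisfies (1/σ²)R(s₀) ≤ r★, and ‖H_s‖_op ≤ h_op for all s ∈ S with h_op ≥ 1. Then there is a universal constant C (independent of n, σ, θ₀, S, the matrices, r★, and h_op) such that edf ≤ C(√(r★ log|S|) + h_op log|S| · (1 + max{0, log(h_op² log|S| / r★)})). -/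
open MeasureTheory ProbabilityTheory Matrix Real

/-- The ℓ²→ℓ² operator (spectral) norm of a real square matrix. -/
noncomputable def opNorm {n : ℕ} (A : Matrix (Fin n) (Fin n) ℝ) : ℝ :=
  ‖Matrix.toEuclideanCLM (𝕜 := ℝ) A‖

/-- The Gaussian measure `N(0, σ²Iₙ)` on `ℝⁿ` (the law of the noise `Z`). -/
noncomputable def gaussianVec (n : ℕ) (σ : ℝ) : Measure (Fin n → ℝ) :=
  Measure.pi fun _ : Fin n => gaussianReal 0 (σ ^ 2).toNNReal

/-- `SURE(s, y) = ‖y − H_s y‖² + 2σ² tr(H_s)`. -/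
noncomputable def SUREf {n : ℕ} {S : Type} (σ : ℝ)
    (H : S → Matrix (Fin n) (Fin n) ℝ) (s : S) (y : Fin n → ℝ) : ℝ :=
  (∑ i, (y i - (H s).mulVec y i) ^ 2) + 2 * σ ^ 2 * (H s).trace

/-- `R(s) = ‖(I − H_s)θ₀‖² + σ²‖H_s‖_F²`. -/
noncomputable def riskR {n : ℕ} {S : Type} (σ : ℝ) (θ₀ : Fin n → ℝ)
    (H : S → Matrix (Fin n) (Fin n) ℝ) (s : S) : ℝ :=
  (∑ i, (θ₀ i - (H s).mulVec θ₀ i) ^ 2) + σ ^ 2 * ((H s)ᵀ * H s).trace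

/-- `edf = E[(1/σ²)(H_{sh(Y)}Y)ᵀ(Y − θ₀) − tr(H_{sh(Y)})]` for `Y = θ₀ + Z`. -/
noncomputable def edf (n : ℕ) (σ : ℝ) (θ₀ : Fin n → ℝ) {S : Type}
    (H : S → Matrix (Fin n) (Fin n) ℝ) (sh : (Fin n → ℝ) → S) : ℝ :=
  ∫ z, ((1 / σ ^ 2) * ((H (sh (θ₀ + z))).mulVec (θ₀ + z) ⬝ᵥ z)
      - (H (sh (θ₀ + z))).trace) ∂(gaussianVec n σ)

/-- The standard Gaussian measure `N(0, Iₙ)` on `ℝⁿ`. -/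
noncomputable abbrev stdGaussianVec (n : ℕ) : Measure (Fin n → ℝ) :=
  Measure.pi fun _ : Fin n => gaussianReal 0 1

lemma gaussianVec_one (n : ℕ) : gaussianVec n 1 = stdGaussianVec n := by
  simp [gaussianVec, stdGaussianVec]

lemma map_smul_stdGaussianVec (n : ℕ) (σ : ℝ) :
    (stdGaussianVec n).map (fun x => σ • x) = gaussianVec n σ := by
  have h := Measure.pi_map_pi (μ := fun _ : Fin n => gaussianReal 0 1)
    (f := fun _ x => σ * x) (fun _ => by fun_prop)
  have e : (fun x : Fin n → ℝ => σ • x) = fun x i => σ * x i := by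
    ext x i; simp
  rw [stdGaussianVec, e, h, gaussianVec]
  congr 1
  ext1 i
  rw [gaussianReal_map_const_mul]
  congr 1
  · simp
  · ext; simp [sq_nonneg]

lemma inv_sqrt_one_sub_two_mul_le {d : ℝ} (hd : d ≤ 1 / 4) :
    √(1 / (1 - 2 * d)) ≤ exp (d + 4 * d ^ 2) := by
  have hpos : 0 < 1 - 2 * d := by linarith
  have h1 := Real.one_sub_inv_le_log_of_pos hpos
  have h2 : -(2 * d) - 8 * d ^ 2 ≤ 1 - (1 - 2 * d)⁻¹ := by
    have : 1 - (1 - 2 * d)⁻¹ - (-(2 * d) - 8 * d ^ 2)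
        = 4 * d ^ 2 * (1 - 4 * d) / (1 - 2 * d) := by
      field_simp; ring
    have h3 : 0 ≤ 4 * d ^ 2 * (1 - 4 * d) / (1 - 2 * d) :=
      div_nonneg (mul_nonneg (by positivity) (by linarith)) hpos.le
    linarith
  rw [Real.sqrt_le_left (exp_pos _).le, ← Real.exp_nat_mul, one_div,
    ← Real.exp_log (inv_pos.2 hpos), Real.exp_le_exp, Real.log_inv]
  push_cast
  linarith

lemma gaussianPDFReal_mul_exp_quadratic (w x : ℝ) {d : ℝ} (hd : d < 1 / 2) :
    gaussianPDFReal 0 1 x * exp (w * x + d * x ^ 2)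
      = ((√(2 * π))⁻¹ * exp (w ^ 2 / (2 * (1 - 2 * d))))
        * exp (-(1 / 2 - d) * (x - w / (1 - 2 * d)) ^ 2) := by
  have hpos : 1 - 2 * d ≠ 0 := by linarith
  rw [gaussianPDFReal_def]
  simp only [NNReal.coe_one, mul_one, sub_zero]
  rw [mul_assoc, mul_assoc, ← Real.exp_add, ← Real.exp_add]
  congr 2
  field_simp
  ring

lemma integrable_exp_quadratic_gaussianReal (w : ℝ) {d : ℝ} (hd : d < 1 / 2) :
    Integrable (fun x => exp (w * x + d * x ^ 2)) (gaussianReal 0 1) := by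
  rw [gaussianReal_of_var_ne_zero _ one_ne_zero, integrable_withDensity_iff_integrable_smul'
    (measurable_gaussianPDF _ _) (ae_of_all _ fun _ ↦ gaussianPDF_lt_top)]
  simp only [toReal_gaussianPDF, smul_eq_mul, gaussianPDFReal_mul_exp_quadratic w _ hd]
  exact ((integrable_exp_neg_mul_sq (by linarith : 0 < 1 / 2 - d)).comp_sub_right _).const_mul _

lemma integral_exp_quadratic_gaussianReal_le (w : ℝ) {d : ℝ} (hd : d ≤ 1 / 4) :
    ∫ x, exp (w * x + d * x ^ 2) ∂(gaussianReal 0 1) ≤ exp (w ^ 2 + d + 4 * d ^ 2) := by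
  have hd' : d < 1 / 2 := by linarith
  have hpos : 0 < 1 - 2 * d := by linarith
  rw [integral_gaussianReal_eq_integral_smul one_ne_zero]
  simp only [smul_eq_mul, gaussianPDFReal_mul_exp_quadratic w _ hd']
  rw [integral_const_mul,
    integral_sub_right_eq_self (fun x => exp (-(1 / 2 - d) * x ^ 2)), integral_gaussian]
  have e : (√(2 * π))⁻¹ * √(π / (1 / 2 - d)) = √(1 / (1 - 2 * d)) := by
    rw [← Real.sqrt_inv, ← Real.sqrt_mul (by positivity)]
    congr 1
    have : (1 / 2 - d) ≠ 0 := by linarith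
    have := pi_ne_zero
    field_simp
  calc _ = √(1 / (1 - 2 * d)) * exp (w ^ 2 / (2 * (1 - 2 * d))) := by rw [← e]; ring
    _ ≤ exp (d + 4 * d ^ 2) * exp (w ^ 2) := by
        gcongr
        · exact inv_sqrt_one_sub_two_mul_le hd
        · exact div_le_self (sq_nonneg w) (by linarith)
    _ = _ := by rw [← Real.exp_add]; congr 1; ring

lemma integrable_exp_diagonal_stdGaussianVec {n : ℕ} (w d : Fin n → ℝ) (hd : ∀ i, d i ≤ 1 / 4) :
    Integrable (fun x : Fin n → ℝ => exp (∑ i, (w i * x i + d i * x i ^ 2)))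
      (stdGaussianVec n) := by
  simp_rw [Real.exp_sum]
  exact Integrable.fintype_prod (f := fun i (x : ℝ) => exp (w i * x + d i * x ^ 2))
    fun i => integrable_exp_quadratic_gaussianReal _ (by linarith [hd i])

lemma integral_exp_diagonal_stdGaussianVec_le {n : ℕ} (w d : Fin n → ℝ) (hd : ∀ i, d i ≤ 1 / 4) :
    ∫ x, exp (∑ i, (w i * x i + d i * x i ^ 2)) ∂(stdGaussianVec n)
      ≤ exp (∑ i, (w i ^ 2 + d i + 4 * d i ^ 2)) := by
  simp_rw [Real.exp_sum]
  rw [integral_fintype_prod_eq_prod (f := fun i (x : ℝ) => exp (w i * x + d i * x ^ 2))]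
  exact Finset.prod_le_prod (fun i _ => integral_nonneg fun x => (exp_pos _).le)
    fun i _ => integral_exp_quadratic_gaussianReal_le _ (hd i)

lemma map_eigenvectorUnitary_stdGaussianVec {n : ℕ} {M : Matrix (Fin n) (Fin n) ℝ}
    (hM : M.IsHermitian) :
    (stdGaussianVec n).map (fun x => (hM.eigenvectorUnitary : Matrix _ _ ℝ) *ᵥ x)
      = stdGaussianVec n := by
  have h := (map_pi_eq_stdGaussian (ι := Fin n)).trans
    (stdGaussian_eq_map_pi_orthonormalBasis hM.eigenvectorBasis)
  have h' := congrArg (Measure.map (WithLp.ofLp)) h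
  rw [Measure.map_map (by fun_prop) (by fun_prop), Measure.map_map (by fun_prop) (by fun_prop)] at h'
  have e : (WithLp.ofLp ∘ fun x : Fin n → ℝ => ∑ i, x i • hM.eigenvectorBasis i)
      = fun x => (hM.eigenvectorUnitary : Matrix _ _ ℝ) *ᵥ x := by
    ext x j
    simp [Matrix.mulVec, dotProduct, mul_comm]
  rw [e] at h'
  rw [← h']
  exact Measure.map_id

/-- In eigencoordinates the form `w ⬝ z + z ⬝ M z` is diagonal. -/
lemma exists_diagonalization_stdGaussianVec {n : ℕ} {M : Matrix (Fin n) (Fin n) ℝ}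
    (hM : Mᵀ = M) (hle : ∀ v, v ⬝ᵥ M *ᵥ v ≤ 1 / 4 * (v ⬝ᵥ v)) (w : Fin n → ℝ) :
    ∃ (U : Matrix (Fin n) (Fin n) ℝ) (w' d : Fin n → ℝ),
      (stdGaussianVec n).map (fun x => U *ᵥ x) = stdGaussianVec n ∧ (∀ i, d i ≤ 1 / 4) ∧
      (∀ x, w ⬝ᵥ U *ᵥ x + U *ᵥ x ⬝ᵥ M *ᵥ (U *ᵥ x) = ∑ i, (w' i * x i + d i * x i ^ 2)) ∧
      ∑ i, (w' i ^ 2 + d i + 4 * d i ^ 2) = w ⬝ᵥ w + M.trace + 4 * (M * M).trace := by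
  have hH : M.IsHermitian := by
    rw [Matrix.IsHermitian, Matrix.conjTranspose_eq_transpose_of_trivial, hM]
  set U : Matrix (Fin n) (Fin n) ℝ := hH.eigenvectorUnitary.1 with hU
  have hU1 : Uᵀ * U = 1 := by
    simpa [hU, Matrix.star_eq_conjTranspose] using Unitary.coe_star_mul_self hH.eigenvectorUnitary
  have hU2 : U * Uᵀ = 1 := mul_eq_one_comm.1 hU1
  have hspec : M = U * diagonal hH.eigenvalues * Uᵀ := by
    have := hH.spectral_theorem
    simpa [hU, Unitary.conjStarAlgAut_apply, Matrix.star_eq_conjTranspose, Function.comp_def]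
      using this
  have hspec' : Uᵀ * M * U = diagonal hH.eigenvalues := by
    calc Uᵀ * M * U = (Uᵀ * U) * diagonal hH.eigenvalues * (Uᵀ * U) := by
          conv_lhs => rw [hspec]
          simp only [Matrix.mul_assoc]
      _ = _ := by rw [hU1]; simp
  have hquad : ∀ x, U *ᵥ x ⬝ᵥ M *ᵥ (U *ᵥ x) = ∑ i, hH.eigenvalues i * x i ^ 2 := by
    intro x
    have : U *ᵥ x ⬝ᵥ M *ᵥ (U *ᵥ x) = x ⬝ᵥ (Uᵀ * M * U) *ᵥ x := by
      rw [← Matrix.mulVec_mulVec, ← Matrix.mulVec_mulVec, Matrix.dotProduct_mulVec x Uᵀ,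
        Matrix.vecMul_transpose]
    rw [this, hspec']
    simp only [dotProduct, Matrix.mulVec_diagonal]
    exact Finset.sum_congr rfl fun i _ => by ring
  have hnorm : ∀ x, U *ᵥ x ⬝ᵥ U *ᵥ x = x ⬝ᵥ x := by
    intro x
    rw [Matrix.dotProduct_mulVec, Matrix.vecMul_mulVec, hU1, Matrix.vecMul_one]
  refine ⟨U, Uᵀ *ᵥ w, hH.eigenvalues, map_eigenvectorUnitary_stdGaussianVec hH, ?_, ?_, ?_⟩
  · intro i
    have h := hle (U *ᵥ Pi.single i 1)
    rw [hquad, hnorm] at h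
    simpa [Pi.single_apply] using h
  · intro x
    rw [hquad, Finset.sum_add_distrib, Matrix.dotProduct_mulVec, ← Matrix.mulVec_transpose]
    rfl
  · have h1 : ∑ i, (Uᵀ *ᵥ w) i ^ 2 = w ⬝ᵥ w := by
      have : (Uᵀ *ᵥ w) ⬝ᵥ (Uᵀ *ᵥ w) = w ⬝ᵥ w := by
        rw [Matrix.dotProduct_mulVec, Matrix.vecMul_mulVec, Matrix.transpose_transpose, hU2,
          Matrix.vecMul_one]
      rw [← this]
      exact Finset.sum_congr rfl fun i _ => by ring
    have h2 : M.trace = ∑ i, hH.eigenvalues i := by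
      conv_lhs => rw [hspec]
      rw [Matrix.trace_mul_comm, ← Matrix.mul_assoc, hU1]
      simp [Matrix.trace_diagonal]
    have h3 : (M * M).trace = ∑ i, hH.eigenvalues i ^ 2 := by
      have : M * M = U * (diagonal hH.eigenvalues * diagonal hH.eigenvalues) * Uᵀ := by
        calc M * M = U * diagonal hH.eigenvalues * (Uᵀ * U) * diagonal hH.eigenvalues * Uᵀ := by
              conv_lhs => rw [hspec]
              simp only [Matrix.mul_assoc]
          _ = _ := by rw [hU1]; simp only [Matrix.mul_assoc, Matrix.mul_one]
      rw [this, Matrix.trace_mul_comm, ← Matrix.mul_assoc, hU1]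
      simp [Matrix.trace_diagonal, sq]
    rw [Finset.sum_add_distrib, Finset.sum_add_distrib, ← Finset.mul_sum, h1, h2, h3]

/-- Exponential moments of a quadratic polynomial of a standard Gaussian vector. -/
lemma integral_exp_quadratic_stdGaussianVec_le {n : ℕ} {M : Matrix (Fin n) (Fin n) ℝ}
    (hM : Mᵀ = M) (hle : ∀ v, v ⬝ᵥ M *ᵥ v ≤ 1 / 4 * (v ⬝ᵥ v)) (w : Fin n → ℝ) :
    Integrable (fun z => exp (w ⬝ᵥ z + z ⬝ᵥ M *ᵥ z)) (stdGaussianVec n) ∧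
    ∫ z, exp (w ⬝ᵥ z + z ⬝ᵥ M *ᵥ z) ∂(stdGaussianVec n)
      ≤ exp (w ⬝ᵥ w + M.trace + 4 * (M * M).trace) := by
  obtain ⟨U, w', d, hmap, hd, hq, hs⟩ := exists_diagonalization_stdGaussianVec hM hle w
  have hUm : Measurable fun x : Fin n → ℝ => U *ᵥ x :=
    (Continuous.matrix_mulVec continuous_const continuous_id).measurable
  have hfc : Continuous fun z : Fin n → ℝ => exp (w ⬝ᵥ z + z ⬝ᵥ M *ᵥ z) := by
    have : Continuous fun z : Fin n → ℝ => M *ᵥ z :=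
      Continuous.matrix_mulVec continuous_const continuous_id
    fun_prop
  have key : ((fun z => exp (w ⬝ᵥ z + z ⬝ᵥ M *ᵥ z)) ∘ fun x => U *ᵥ x)
      = fun x => exp (∑ i, (w' i * x i + d i * x i ^ 2)) := by
    ext x
    simp only [Function.comp_apply, hq]
  constructor
  · rw [← hmap, integrable_map_measure hfc.aestronglyMeasurable hUm.aemeasurable, key]
    exact integrable_exp_diagonal_stdGaussianVec w' d hd
  · rw [← hmap, integral_map hUm.aemeasurable hfc.aestronglyMeasurable, ← hs]
    simp only [hq]
    exact integral_exp_diagonal_stdGaussianVec_le w' d hd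

lemma integrable_eval_mul_eval_stdGaussianVec {n : ℕ} (i j : Fin n) :
    Integrable (fun z : Fin n → ℝ => z i * z j) (stdGaussianVec n) := by
  have h (k : Fin n) : MemLp (fun z : Fin n → ℝ => z k) 2 (stdGaussianVec n) :=
    (memLp_id_gaussianReal' (μ := 0) (v := 1) 2 (by simp)).comp_measurePreserving
      (measurePreserving_eval (fun _ : Fin n => gaussianReal 0 1) k)
  exact (h i).integrable_mul (h j)

lemma integral_eval_stdGaussianVec {n : ℕ} (i : Fin n) :
    ∫ z : Fin n → ℝ, z i ∂(stdGaussianVec n) = 0 := by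
  rw [stdGaussianVec, integral_eval (μ := fun _ : Fin n => gaussianReal 0 1)]
  exact integral_id_gaussianReal

lemma integral_eval_mul_eval_stdGaussianVec {n : ℕ} (i j : Fin n) :
    ∫ z : Fin n → ℝ, z i * z j ∂(stdGaussianVec n) = if i = j then 1 else 0 := by
  split_ifs with h
  · subst h
    have h1 := integral_comp_eval (μ := fun _ : Fin n => gaussianReal 0 1) (i := i)
      (f := fun x : ℝ => x * x) (by fun_prop)
    rw [stdGaussianVec, h1]
    have h2 := variance_id_gaussianReal (μ := 0) (v := 1)
    rw [variance_eq_integral (by fun_prop)] at h2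
    simpa [sq] using h2
  · have hind : IndepFun (fun z : Fin n → ℝ => z i) (fun z => z j) (stdGaussianVec n) :=
      (iIndepFun_pi (μ := fun _ : Fin n => gaussianReal 0 1) (X := fun _ x => x)
        (fun _ => by fun_prop)).indepFun h
    rw [hind.integral_fun_mul_eq_mul_integral (measurable_pi_apply i).aestronglyMeasurable
      (measurable_pi_apply j).aestronglyMeasurable, integral_eval_stdGaussianVec, zero_mul]

lemma quadratic_eq_sum {n : ℕ} (M : Matrix (Fin n) (Fin n) ℝ) (w z : Fin n → ℝ) :
    w ⬝ᵥ z + z ⬝ᵥ M *ᵥ z = ∑ i, w i * z i + ∑ i, ∑ j, M i j * (z i * z j) := by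
  simp only [dotProduct, Matrix.mulVec, Finset.mul_sum]
  congr 1
  exact Finset.sum_congr rfl fun i _ => Finset.sum_congr rfl fun j _ => by ring

lemma integrable_quadratic_stdGaussianVec {n : ℕ} (M : Matrix (Fin n) (Fin n) ℝ)
    (w : Fin n → ℝ) :
    Integrable (fun z => w ⬝ᵥ z + z ⬝ᵥ M *ᵥ z) (stdGaussianVec n) := by
  simp only [quadratic_eq_sum]
  refine (integrable_finsetSum _ fun i _ => (integrable_eval ?_).const_mul _).add
    (integrable_finsetSum _ fun i _ => integrable_finsetSum _ fun j _ =>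
      (integrable_eval_mul_eval_stdGaussianVec i j).const_mul _)
  exact IsGaussian.integrable_id

lemma integral_quadratic_stdGaussianVec {n : ℕ} (M : Matrix (Fin n) (Fin n) ℝ)
    (w : Fin n → ℝ) :
    ∫ z, (w ⬝ᵥ z + z ⬝ᵥ M *ᵥ z) ∂(stdGaussianVec n) = M.trace := by
  have h1 (i : Fin n) : Integrable (fun z : Fin n → ℝ => w i * z i) (stdGaussianVec n) := by
    refine (integrable_eval ?_).const_mul _
    exact IsGaussian.integrable_id
  have h2 (i j : Fin n) :
      Integrable (fun z : Fin n → ℝ => M i j * (z i * z j)) (stdGaussianVec n) :=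
    (integrable_eval_mul_eval_stdGaussianVec i j).const_mul _
  simp only [quadratic_eq_sum]
  rw [integral_add (integrable_finsetSum _ fun i _ => h1 i)
    (integrable_finsetSum _ fun i _ => integrable_finsetSum _ fun j _ => h2 i j),
    integral_finsetSum _ fun i _ => h1 i,
    integral_finsetSum _ fun i _ => integrable_finsetSum _ fun j _ => h2 i j]
  simp only [integral_finsetSum _ fun j _ => h2 _ j, integral_const_mul,
    integral_eval_stdGaussianVec, integral_eval_mul_eval_stdGaussianVec]
  simp [Matrix.trace]

lemma mulVec_dotProduct_self_le_of_opNorm_le {n : ℕ} {A : Matrix (Fin n) (Fin n) ℝ} {h : ℝ}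
    (hA : opNorm A ≤ h) (x : Fin n → ℝ) :
    A *ᵥ x ⬝ᵥ A *ᵥ x ≤ h ^ 2 * (x ⬝ᵥ x) := by
  have key (v : Fin n → ℝ) : v ⬝ᵥ v = ‖WithLp.toLp 2 v‖ ^ 2 := by
    rw [EuclideanSpace.real_norm_sq_eq]
    simp [dotProduct, sq]
  have h1 := (Matrix.toEuclideanCLM (𝕜 := ℝ) A).le_opNorm (WithLp.toLp 2 x)
  have h2 : ‖Matrix.toEuclideanCLM (𝕜 := ℝ) A (WithLp.toLp 2 x)‖ ≤ h * ‖WithLp.toLp 2 x‖ :=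
    h1.trans (by gcongr; exact hA)
  rw [Matrix.toEuclideanCLM_toLp] at h2
  rw [key, key, ← mul_pow]
  gcongr

lemma transpose_mulVec_dotProduct_self_le_of_opNorm_le {n : ℕ} {A : Matrix (Fin n) (Fin n) ℝ}
    {h : ℝ} (hA : opNorm A ≤ h) (x : Fin n → ℝ) :
    Aᵀ *ᵥ x ⬝ᵥ Aᵀ *ᵥ x ≤ h ^ 2 * (x ⬝ᵥ x) := by
  refine mulVec_dotProduct_self_le_of_opNorm_le ?_ x
  rw [opNorm, ← Matrix.conjTranspose_eq_transpose_of_trivial, ← Matrix.star_eq_conjTranspose,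
    map_star]
  exact (norm_star (Matrix.toEuclideanCLM (𝕜 := ℝ) A)).trans_le hA

lemma trace_transpose_mul_self_eq_sum {n : ℕ} (A : Matrix (Fin n) (Fin n) ℝ) :
    (Aᵀ * A).trace = ∑ j, A.col j ⬝ᵥ A.col j := by
  simp [Matrix.trace, Matrix.mul_apply, dotProduct]

lemma trace_transpose_mul_self_eq_sum_sq {n : ℕ} (A : Matrix (Fin n) (Fin n) ℝ) :
    (Aᵀ * A).trace = ∑ i, ∑ j, A i j ^ 2 := by
  rw [Finset.sum_comm]
  simp [Matrix.trace, Matrix.mul_apply, sq]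

lemma trace_sq_gram_le_of_opNorm_le {n : ℕ} {A : Matrix (Fin n) (Fin n) ℝ} {h : ℝ}
    (hA : opNorm A ≤ h) :
    ∑ i, ∑ j, (Aᵀ * A) i j ^ 2 ≤ h ^ 2 * (Aᵀ * A).trace := by
  rw [← trace_transpose_mul_self_eq_sum_sq, trace_transpose_mul_self_eq_sum,
    trace_transpose_mul_self_eq_sum A, Finset.mul_sum]
  exact Finset.sum_le_sum fun j _ =>
    transpose_mulVec_dotProduct_self_le_of_opNorm_le hA (A.col j)

/-- The centred excess `(A(θ + z) − θ)ᵀ z − tr A` at unit noise level. -/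
noncomputable def centredExcess {n : ℕ} (θ : Fin n → ℝ) (A : Matrix (Fin n) (Fin n) ℝ)
    (z : Fin n → ℝ) : ℝ :=
  (A *ᵥ θ - θ) ⬝ᵥ z + z ⬝ᵥ A *ᵥ z - A.trace

/-- The squared loss `‖A(θ + z) − θ‖²`. -/
noncomputable def sqLoss {n : ℕ} (θ : Fin n → ℝ) (A : Matrix (Fin n) (Fin n) ℝ)
    (z : Fin n → ℝ) : ℝ :=
  (A *ᵥ θ - θ + A *ᵥ z) ⬝ᵥ (A *ᵥ θ - θ + A *ᵥ z)

lemma sqLoss_eq {n : ℕ} (θ : Fin n → ℝ) (A : Matrix (Fin n) (Fin n) ℝ) (z : Fin n → ℝ) :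
    sqLoss θ A z = (A *ᵥ θ - θ) ⬝ᵥ (A *ᵥ θ - θ) + 2 * (Aᵀ *ᵥ (A *ᵥ θ - θ) ⬝ᵥ z)
      + z ⬝ᵥ (Aᵀ * A) *ᵥ z := by
  have h1 : Aᵀ *ᵥ (A *ᵥ θ - θ) ⬝ᵥ z = (A *ᵥ θ - θ) ⬝ᵥ A *ᵥ z := by
    rw [Matrix.mulVec_transpose, ← Matrix.dotProduct_mulVec]
  have h2 : z ⬝ᵥ (Aᵀ * A) *ᵥ z = A *ᵥ z ⬝ᵥ A *ᵥ z := by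
    rw [← Matrix.mulVec_mulVec, Matrix.dotProduct_mulVec z, Matrix.vecMul_transpose]
  rw [sqLoss, h1, h2, add_dotProduct, dotProduct_add, dotProduct_add,
    dotProduct_comm (A *ᵥ z) (A *ᵥ θ - θ)]
  ring

lemma riskR_one {n : ℕ} {S : Type} (θ : Fin n → ℝ) (H : S → Matrix (Fin n) (Fin n) ℝ) (s : S) :
    riskR 1 θ H s = (H s *ᵥ θ - θ) ⬝ᵥ (H s *ᵥ θ - θ) + ((H s)ᵀ * H s).trace := by
  simp only [riskR, one_pow, one_mul, dotProduct, Pi.sub_apply]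
  congr 1
  exact Finset.sum_congr rfl fun i _ => by ring

lemma SUREf_one_add {n : ℕ} {S : Type} (θ : Fin n → ℝ) (H : S → Matrix (Fin n) (Fin n) ℝ)
    (s : S) (z : Fin n → ℝ) :
    SUREf 1 H s (θ + z) = z ⬝ᵥ z + sqLoss θ (H s) z - 2 * centredExcess θ (H s) z := by
  have h : ∑ i, ((θ + z) i - (H s *ᵥ (θ + z)) i) ^ 2
      = z ⬝ᵥ z + sqLoss θ (H s) z - 2 * ((H s *ᵥ θ - θ) ⬝ᵥ z + z ⬝ᵥ H s *ᵥ z) := by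
    simp only [sqLoss, dotProduct, Matrix.mulVec_add, Pi.add_apply, Pi.sub_apply,
      ← Finset.sum_add_distrib, Finset.mul_sum, ← Finset.sum_sub_distrib]
    exact Finset.sum_congr rfl fun i _ => by ring
  rw [SUREf, h, centredExcess]
  ring

lemma sqLoss_sub_centredExcess_eq {n : ℕ} (θ : Fin n → ℝ) (A : Matrix (Fin n) (Fin n) ℝ)
    (z : Fin n → ℝ) :
    sqLoss θ A z - 2 * centredExcess θ A z
      = ((2 : ℝ) • (Aᵀ *ᵥ (A *ᵥ θ - θ)) - (2 : ℝ) • (A *ᵥ θ - θ)) ⬝ᵥ z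
        + z ⬝ᵥ (Aᵀ * A - (2 : ℝ) • A) *ᵥ z
        + ((A *ᵥ θ - θ) ⬝ᵥ (A *ᵥ θ - θ) + 2 * A.trace) := by
  rw [sqLoss_eq, centredExcess]
  generalize A *ᵥ θ - θ = u
  rw [sub_dotProduct, Matrix.sub_mulVec, dotProduct_sub, Matrix.smul_mulVec]
  simp only [smul_dotProduct, dotProduct_smul, smul_eq_mul]
  ring

lemma integrable_sqLoss_sub_centredExcess {n : ℕ} (θ : Fin n → ℝ)
    (A : Matrix (Fin n) (Fin n) ℝ) :
    Integrable (fun z => sqLoss θ A z - 2 * centredExcess θ A z) (stdGaussianVec n) := by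
  simp only [sqLoss_sub_centredExcess_eq]
  exact (integrable_quadratic_stdGaussianVec _ _).add (integrable_const _)

lemma integral_sqLoss_sub_centredExcess {n : ℕ} (θ : Fin n → ℝ)
    (A : Matrix (Fin n) (Fin n) ℝ) :
    ∫ z, (sqLoss θ A z - 2 * centredExcess θ A z) ∂(stdGaussianVec n)
      = (A *ᵥ θ - θ) ⬝ᵥ (A *ᵥ θ - θ) + (Aᵀ * A).trace := by
  simp only [sqLoss_sub_centredExcess_eq]
  rw [integral_add (integrable_quadratic_stdGaussianVec _ _) (integrable_const _),
    integral_quadratic_stdGaussianVec]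
  simp [Matrix.trace_sub, Matrix.trace_smul]
  ring

/-- The exponentially tilted combination of excess and loss has exponential moment at most one. -/
lemma integral_exp_centredExcess_sub_sqLoss_le_one {n : ℕ} (θ : Fin n → ℝ)
    {A : Matrix (Fin n) (Fin n) ℝ} {h a : ℝ} (hA : opNorm A ≤ h) (ha : 0 < a) (ha1 : a ≤ 1)
    (hah : a * h ≤ 1) (hh : 0 ≤ h) :
    Integrable (fun z => exp (a / 66 * ((1 + 2 * a) * centredExcess θ A z - a * sqLoss θ A z)))
      (stdGaussianVec n) ∧
    ∫ z, exp (a / 66 * ((1 + 2 * a) * centredExcess θ A z - a * sqLoss θ A z))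
      ∂(stdGaussianVec n) ≤ 1 := by
  set u : Fin n → ℝ := A *ᵥ θ - θ with hu
  set l : ℝ := a / 66 with hl
  set F : ℝ := (Aᵀ * A).trace with hF
  have hl0 : 0 < l := by positivity
  have hah2 : a ^ 2 * h ^ 2 ≤ 1 := by
    rw [← mul_pow]
    exact pow_le_one₀ (by positivity) hah
  have hF0 : 0 ≤ F := by
    rw [hF, trace_transpose_mul_self_eq_sum_sq]; positivity
  have hu0 : 0 ≤ u ⬝ᵥ u := Finset.sum_nonneg fun i _ => mul_self_nonneg _
  set w : Fin n → ℝ := l • ((1 + 2 * a) • u - (2 * a) • (Aᵀ *ᵥ u)) with hw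
  set M : Matrix (Fin n) (Fin n) ℝ := l • (((1 + 2 * a) / 2) • (A + Aᵀ) - a • (Aᵀ * A)) with hM
  have hquad (z : Fin n → ℝ) : z ⬝ᵥ M *ᵥ z
      = l * ((1 + 2 * a) * (z ⬝ᵥ A *ᵥ z) - a * (A *ᵥ z ⬝ᵥ A *ᵥ z)) := by
    have h1 : z ⬝ᵥ Aᵀ *ᵥ z = z ⬝ᵥ A *ᵥ z := by
      rw [Matrix.mulVec_transpose, dotProduct_comm, ← Matrix.dotProduct_mulVec]
    have h2 : z ⬝ᵥ (Aᵀ * A) *ᵥ z = A *ᵥ z ⬝ᵥ A *ᵥ z := by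
      rw [← Matrix.mulVec_mulVec, Matrix.dotProduct_mulVec z, Matrix.vecMul_transpose]
    simp only [hM, Matrix.smul_mulVec, Matrix.sub_mulVec, Matrix.add_mulVec, dotProduct_smul,
      dotProduct_sub, dotProduct_add, smul_eq_mul, h1, h2]
    ring
  have htr : M.trace = l * ((1 + 2 * a) * A.trace - a * F) := by
    simp only [hM, Matrix.trace_smul, Matrix.trace_sub, Matrix.trace_add, Matrix.trace_transpose,
      smul_eq_mul, hF]
    ring
  have hsymm : Mᵀ = M := by
    simp only [hM, Matrix.transpose_smul, Matrix.transpose_sub, Matrix.transpose_add,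
      Matrix.transpose_mul, Matrix.transpose_transpose, add_comm]
  have hle (v : Fin n → ℝ) : v ⬝ᵥ M *ᵥ v ≤ 1 / 4 * (v ⬝ᵥ v) := by
    rw [hquad]
    have hv0 : 0 ≤ v ⬝ᵥ v := Finset.sum_nonneg fun i _ => mul_self_nonneg _
    have hsq : 0 ≤ ((2 * a) • (A *ᵥ v) - (1 + 2 * a) • v)
        ⬝ᵥ ((2 * a) • (A *ᵥ v) - (1 + 2 * a) • v) := Finset.sum_nonneg fun i _ => mul_self_nonneg _
    simp only [sub_dotProduct, dotProduct_sub, smul_dotProduct, dotProduct_smul, smul_eq_mul,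
      dotProduct_comm (A *ᵥ v) v] at hsq
    have h9 : (1 + 2 * a) ^ 2 * (v ⬝ᵥ v) ≤ 9 * (v ⬝ᵥ v) := by
      gcongr
      nlinarith
    have : a * ((1 + 2 * a) * (v ⬝ᵥ A *ᵥ v) - a * (A *ᵥ v ⬝ᵥ A *ᵥ v)) ≤ 9 / 4 * (v ⬝ᵥ v) := by
      nlinarith
    rw [hl]
    linarith
  have hww : w ⬝ᵥ w ≤ l ^ 2 * (26 * (u ⬝ᵥ u)) := by
    have h1 := transpose_mulVec_dotProduct_self_le_of_opNorm_le hA u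
    have hsq : 0 ≤ ((1 + 2 * a) • u + (2 * a) • (Aᵀ *ᵥ u))
        ⬝ᵥ ((1 + 2 * a) • u + (2 * a) • (Aᵀ *ᵥ u)) := Finset.sum_nonneg fun i _ => mul_self_nonneg _
    have h9 : (1 + 2 * a) ^ 2 * (u ⬝ᵥ u) ≤ 9 * (u ⬝ᵥ u) := by
      gcongr
      nlinarith
    have h4 : a ^ 2 * (Aᵀ *ᵥ u ⬝ᵥ Aᵀ *ᵥ u) ≤ u ⬝ᵥ u := by
      calc _ ≤ a ^ 2 * (h ^ 2 * (u ⬝ᵥ u)) := by gcongr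
        _ = (a ^ 2 * h ^ 2) * (u ⬝ᵥ u) := by ring
        _ ≤ 1 * (u ⬝ᵥ u) := by gcongr
        _ = _ := one_mul _
    have e : w ⬝ᵥ w = l ^ 2 * (((1 + 2 * a) • u - (2 * a) • (Aᵀ *ᵥ u))
        ⬝ᵥ ((1 + 2 * a) • u - (2 * a) • (Aᵀ *ᵥ u))) := by
      rw [hw, smul_dotProduct, dotProduct_smul, smul_eq_mul, smul_eq_mul]
      ring
    rw [e]
    gcongr
    simp only [add_dotProduct, dotProduct_add, sub_dotProduct, dotProduct_sub, smul_dotProduct,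
      dotProduct_smul, smul_eq_mul] at hsq ⊢
    nlinarith
  have hMM : (M * M).trace ≤ l ^ 2 * (33 / 2 * F) := by
    have e : (M * M).trace = ∑ i, ∑ j, M i j ^ 2 := by
      rw [← trace_transpose_mul_self_eq_sum_sq, hsymm]
    have hG := trace_sq_gram_le_of_opNorm_le hA
    have hF1 : F = ∑ i, ∑ j, A i j ^ 2 := trace_transpose_mul_self_eq_sum_sq A
    have hF2 : F = ∑ i, ∑ j, A j i ^ 2 := by rw [hF1, Finset.sum_comm]
    have hb (i j : Fin n) : M i j ^ 2
        ≤ l ^ 2 * (27 / 4 * A i j ^ 2 + 27 / 4 * A j i ^ 2 + 3 * a ^ 2 * (Aᵀ * A) i j ^ 2) := by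
      have e1 : M i j = l * ((1 + 2 * a) / 2 * (A i j + A j i) - a * (Aᵀ * A) i j) := by
        simp only [hM, Matrix.smul_apply, Matrix.sub_apply, Matrix.add_apply,
          Matrix.transpose_apply, smul_eq_mul]
      rw [e1, mul_pow]
      gcongr
      generalize (Aᵀ * A) i j = g
      have hc : ((1 + 2 * a) / 2) ^ 2 ≤ 9 / 4 := by nlinarith
      have h1 := mul_le_mul_of_nonneg_right hc (sq_nonneg (A i j))
      have h2 := mul_le_mul_of_nonneg_right hc (sq_nonneg (A j i))
      have h3 (x y t : ℝ) : (x + y - t) ^ 2 ≤ 3 * x ^ 2 + 3 * y ^ 2 + 3 * t ^ 2 := by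
        nlinarith [sq_nonneg (x - y), sq_nonneg (x + t), sq_nonneg (y + t)]
      have h4 := h3 ((1 + 2 * a) / 2 * A i j) ((1 + 2 * a) / 2 * A j i) (a * g)
      simp only [mul_pow] at h4
      rw [mul_add]
      linarith
    have hsum := Finset.sum_le_sum fun i (_ : i ∈ Finset.univ) =>
      Finset.sum_le_sum fun j (_ : j ∈ Finset.univ) => hb i j
    rw [e]
    refine hsum.trans ?_
    simp only [← Finset.mul_sum, Finset.sum_add_distrib]
    rw [← hF1, ← hF2]
    gcongr
    have : a ^ 2 * (∑ i, ∑ j, (Aᵀ * A) i j ^ 2) ≤ F := by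
      calc _ ≤ a ^ 2 * (h ^ 2 * F) := by gcongr
        _ = (a ^ 2 * h ^ 2) * F := by ring
        _ ≤ 1 * F := by gcongr
        _ = _ := one_mul _
    linarith
  have hexp (z : Fin n → ℝ) :
      exp (l * ((1 + 2 * a) * centredExcess θ A z - a * sqLoss θ A z))
        = exp (-(M.trace + l * a * (u ⬝ᵥ u + F))) * exp (w ⬝ᵥ z + z ⬝ᵥ M *ᵥ z) := by
    have h2 : z ⬝ᵥ (Aᵀ * A) *ᵥ z = A *ᵥ z ⬝ᵥ A *ᵥ z := by
      rw [← Matrix.mulVec_mulVec, Matrix.dotProduct_mulVec z, Matrix.vecMul_transpose]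
    rw [← Real.exp_add, sqLoss_eq, centredExcess, hquad, htr, hw, h2]
    simp only [sub_dotProduct, smul_dotProduct, smul_eq_mul, ← hu]
    congr 1
    ring
  obtain ⟨hint, hbd⟩ := integral_exp_quadratic_stdGaussianVec_le hsymm hle w
  simp only [hexp]
  refine ⟨hint.const_mul _, ?_⟩
  rw [integral_const_mul]
  calc _ ≤ exp (-(M.trace + l * a * (u ⬝ᵥ u + F)))
        * exp (w ⬝ᵥ w + M.trace + 4 * (M * M).trace) := by gcongr
    _ ≤ 1 := by
      rw [← Real.exp_add, Real.exp_le_one_iff]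
      have hla : l * a = 66 * l ^ 2 := by rw [hl]; ring
      rw [hla]
      nlinarith [mul_nonneg (sq_nonneg l) hu0]

lemma edf_one_le {n : ℕ} (θ : Fin n → ℝ) {S : Type} [Fintype S] [Nonempty S]
    (H : S → Matrix (Fin n) (Fin n) ℝ) (sh : (Fin n → ℝ) → S) (s₀ : S)
    (hmin : ∀ y, SUREf 1 H (sh y) y ≤ SUREf 1 H s₀ y) {r h a : ℝ} (hr : riskR 1 θ H s₀ ≤ r)
    (hH : ∀ s, opNorm (H s) ≤ h) (hh : 0 ≤ h) (ha : 0 < a) (ha1 : a ≤ 1) (hah : a * h ≤ 1) :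
    edf n 1 θ H sh ≤ a * r + 66 / a * Real.log (Fintype.card S) := by
  have hN : (0 : ℝ) < Fintype.card S := by exact_mod_cast Fintype.card_pos
  have hlog : 0 ≤ Real.log (Fintype.card S) :=
    Real.log_natCast_nonneg _
  have hR0 : 0 ≤ riskR 1 θ H s₀ := by
    rw [riskR_one, trace_transpose_mul_self_eq_sum_sq]
    have : 0 ≤ (H s₀ *ᵥ θ - θ) ⬝ᵥ (H s₀ *ᵥ θ - θ) := Finset.sum_nonneg fun i _ => mul_self_nonneg _
    positivity
  have hr0 : 0 ≤ r := hR0.trans hr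
  set V : S → (Fin n → ℝ) → ℝ := fun s z =>
    (1 + 2 * a) * centredExcess θ (H s) z - a * sqLoss θ (H s) z with hV
  have hVint (s : S) := integral_exp_centredExcess_sub_sqLoss_le_one θ (hH s) ha ha1 hah hh
  set G : (Fin n → ℝ) → ℝ := fun z =>
    (θ ⬝ᵥ z + z ⬝ᵥ (0 : Matrix (Fin n) (Fin n) ℝ) *ᵥ z)
      + a * (sqLoss θ (H s₀) z - 2 * centredExcess θ (H s₀) z)
      + 66 / a * ((Real.log (Fintype.card S) - 1)
        + (Fintype.card S : ℝ)⁻¹ * ∑ s, exp (a / 66 * V s z)) with hG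
  have i1 := integrable_quadratic_stdGaussianVec (0 : Matrix (Fin n) (Fin n) ℝ) θ
  have i2 := (integrable_sqLoss_sub_centredExcess θ (H s₀)).const_mul a
  have i3 : Integrable (fun z => (Fintype.card S : ℝ)⁻¹ * ∑ s, exp (a / 66 * V s z))
      (stdGaussianVec n) := (integrable_finsetSum _ fun s _ => (hVint s).1).const_mul _
  have i4 := ((integrable_const (μ := stdGaussianVec n)
    (Real.log (Fintype.card S) - 1)).add i3).const_mul (66 / a)
  have hGint : Integrable G (stdGaussianVec n) := (i1.add i2).add i4
  have hGle : ∫ z, G z ∂(stdGaussianVec n) ≤ a * r + 66 / a * Real.log (Fintype.card S) := by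
    have hsum : ∫ z, ∑ s, exp (a / 66 * V s z) ∂(stdGaussianVec n) ≤ Fintype.card S := by
      rw [integral_finsetSum _ fun s _ => (hVint s).1]
      simpa using Finset.sum_le_sum fun s (_ : s ∈ Finset.univ) => (hVint s).2
    have e : ∫ z, G z ∂(stdGaussianVec n) = a * riskR 1 θ H s₀
        + 66 / a * ((Real.log (Fintype.card S) - 1)
        + (Fintype.card S : ℝ)⁻¹ * ∫ z, ∑ s, exp (a / 66 * V s z) ∂(stdGaussianVec n)) := by
      have hadd := (integral_add (i1.add i2) i4).trans (congrArg (· + _) (integral_add i1 i2))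
      refine hadd.trans ?_
      simp only [Pi.add_apply]
      rw [integral_const_mul,
        integral_const_mul, integral_add (integrable_const _) i3, integral_const_mul,
        integral_quadratic_stdGaussianVec, integral_sqLoss_sub_centredExcess, riskR_one]
      simp
    rw [e]
    have : (Fintype.card S : ℝ)⁻¹ * ∫ z, ∑ s, exp (a / 66 * V s z) ∂(stdGaussianVec n) ≤ 1 := by
      calc _ ≤ (Fintype.card S : ℝ)⁻¹ * Fintype.card S := by gcongr
        _ = 1 := inv_mul_cancel₀ hN.ne'
    gcongr
    linarith
  have hpt (z : Fin n → ℝ) : (1 / (1 : ℝ) ^ 2) * ((H (sh (θ + z))).mulVec (θ + z) ⬝ᵥ z)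
      - (H (sh (θ + z))).trace ≤ G z := by
    have hs := hmin (θ + z)
    set s := sh (θ + z)
    rw [SUREf_one_add, SUREf_one_add] at hs
    have e : (1 / (1 : ℝ) ^ 2) * (H s *ᵥ (θ + z) ⬝ᵥ z) - (H s).trace
        = θ ⬝ᵥ z + centredExcess θ (H s) z := by
      rw [centredExcess, Matrix.mulVec_add, add_dotProduct, sub_dotProduct,
        dotProduct_comm (H s *ᵥ z)]
      ring
    have hVs : V s z ≤ 66 / a * ((Real.log (Fintype.card S) - 1)
        + (Fintype.card S : ℝ)⁻¹ * ∑ s, exp (a / 66 * V s z)) := by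
      have h1 : exp (a / 66 * V s z) ≤ ∑ s, exp (a / 66 * V s z) :=
        Finset.single_le_sum (f := fun s => exp (a / 66 * V s z))
          (fun i _ => (exp_pos _).le) (Finset.mem_univ s)
      have h2 := Real.add_one_le_exp (a / 66 * V s z - Real.log (Fintype.card S))
      rw [Real.exp_sub, Real.exp_log hN, div_eq_inv_mul (exp _)] at h2
      have h3 : a / 66 * V s z ≤ (Real.log (Fintype.card S) - 1)
          + (Fintype.card S : ℝ)⁻¹ * ∑ s, exp (a / 66 * V s z) := by
        have := mul_le_mul_of_nonneg_left h1 (inv_pos.2 hN).le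
        linarith
      calc V s z = 66 / a * (a / 66 * V s z) := by field_simp
        _ ≤ _ := by gcongr
    have h4 : centredExcess θ (H s) z
        ≤ V s z + a * (sqLoss θ (H s₀) z - 2 * centredExcess θ (H s₀) z) := by
      have := mul_le_mul_of_nonneg_left hs ha.le
      simp only [hV]
      linarith
    rw [e]
    simp only [hG, Matrix.zero_mulVec, dotProduct_zero]
    linarith
  rw [edf, gaussianVec_one]
  by_cases hint : Integrable (fun z => (1 / (1 : ℝ) ^ 2) *
      ((H (sh (θ + z))).mulVec (θ + z) ⬝ᵥ z) - (H (sh (θ + z))).trace) (stdGaussianVec n)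
  · exact (integral_mono hint hGint hpt).trans hGle
  · rw [integral_undef hint]
    positivity

lemma edf_eq_edf_one (n : ℕ) {σ : ℝ} (hσ : σ ≠ 0) (θ : Fin n → ℝ) {S : Type}
    (H : S → Matrix (Fin n) (Fin n) ℝ) (sh : (Fin n → ℝ) → S) :
    edf n σ θ H sh = edf n 1 (σ⁻¹ • θ) H fun y => sh (σ • y) := by
  have hmap : gaussianVec n σ
      = (stdGaussianVec n).map (Homeomorph.smulOfNeZero σ hσ : (Fin n → ℝ) ≃ₜ (Fin n → ℝ)) :=
    (map_smul_stdGaussianVec n σ).symm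
  rw [edf, edf, gaussianVec_one, hmap,
    (Homeomorph.smulOfNeZero σ hσ).measurableEmbedding.integral_map]
  congr 1
  ext z
  have : θ + Homeomorph.smulOfNeZero σ hσ z = σ • (σ⁻¹ • θ + z) := by
    simp [smul_smul, hσ]
  rw [this]
  simp only [Homeomorph.smulOfNeZero_apply, Matrix.mulVec_smul, smul_dotProduct, dotProduct_smul,
    smul_eq_mul]
  field_simp

lemma SUREf_smul {n : ℕ} {S : Type} (σ : ℝ) (H : S → Matrix (Fin n) (Fin n) ℝ) (s : S)
    (y : Fin n → ℝ) : SUREf σ H s (σ • y) = σ ^ 2 * SUREf 1 H s y := by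
  simp only [SUREf, Matrix.mulVec_smul, Pi.smul_apply, smul_eq_mul, ← mul_sub, mul_pow,
    ← Finset.mul_sum]
  ring

lemma riskR_one_inv_smul {n : ℕ} {S : Type} {σ : ℝ} (hσ : σ ≠ 0) (θ : Fin n → ℝ)
    (H : S → Matrix (Fin n) (Fin n) ℝ) (s : S) :
    riskR 1 (σ⁻¹ • θ) H s = riskR σ θ H s / σ ^ 2 := by
  simp only [riskR, Matrix.mulVec_smul, Pi.smul_apply, smul_eq_mul, ← mul_sub, mul_pow,
    ← Finset.mul_sum]
  field_simp

/-- Optimizing the trade-off `a r + c L / a` over `0 < a ≤ 1 / h`. -/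
lemma le_of_forall_tradeoff {x r h L c : ℝ} (hr : 0 < r) (hh : 1 ≤ h) (hL : 0 ≤ L) (hc : 0 ≤ c)
    (hx : ∀ a, 0 < a → a ≤ 1 → a * h ≤ 1 → x ≤ a * r + c / a * L) :
    x ≤ (c + 1) * (√(r * L) + h * L) := by
  have hh0 : 0 < h := by linarith
  rcases hL.eq_or_lt with rfl | hL
  · simp only [mul_zero, Real.sqrt_zero, add_zero]
    refine le_of_forall_pos_le_add fun ε hε => ?_
    have hm : 0 < min (1 / h) (ε / r) := by positivity
    have h1 : min (1 / h) (ε / r) * h ≤ 1 := by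
      rw [← le_div_iff₀ hh0]; exact min_le_left _ _
    have h2 := hx _ hm (by nlinarith) h1
    have h3 : min (1 / h) (ε / r) * r ≤ ε := by
      rw [← le_div_iff₀ hr]; exact min_le_right _ _
    linarith
  · have hs : 0 < √(L / r) := Real.sqrt_pos.2 (by positivity)
    have hm : 0 < min (1 / h) √(L / r) := by positivity
    have h1 : min (1 / h) √(L / r) * h ≤ 1 := by
      rw [← le_div_iff₀ hh0]; exact min_le_left _ _
    have h2 := hx _ hm (by nlinarith) h1
    have e1 : √(L / r) * r = √(r * L) := by
      rw [Real.sqrt_div hL.le, Real.sqrt_mul hr.le, div_mul_eq_mul_div, div_eq_iff (by positivity)]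
      rw [mul_right_comm, Real.mul_self_sqrt hr.le, mul_comm]
    have e2 : L / √(L / r) = √(r * L) := by
      rw [← e1, div_eq_iff hs.ne', mul_right_comm, Real.mul_self_sqrt (by positivity)]
      field_simp
    have h3 : min (1 / h) √(L / r) * r ≤ √(r * L) := by
      rw [← e1]; gcongr; exact min_le_right _ _
    have h4 : L / min (1 / h) √(L / r) ≤ √(r * L) + h * L := by
      rcases min_choice (1 / h) √(L / r) with hm | hm <;> rw [hm]
      · have : L / (1 / h) = h * L := by field_simp
        rw [this]
        linarith [Real.sqrt_nonneg (r * L)]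
      · rw [e2]
        have : 0 ≤ h * L := by positivity
        linarith
    have h5 : c / min (1 / h) √(L / r) * L = c * (L / min (1 / h) √(L / r)) := by ring
    rw [h5] at h2
    have h6 := mul_le_mul_of_nonneg_left h4 hc
    have : 0 ≤ h * L := by positivity
    linarith

/-- main theorem: a universal-constant bound on the excess degrees
of freedom of an arbitrary SURE-tuned linear estimator:
`edf ≤ C(√(r★ log|S|) + h_op log|S| (1 + log₊(h_op² log|S| / r★)))`. -/
theorem edf_bound_SURE_tuned_linear :
    ∃ C : ℝ, 0 < C ∧
      ∀ (n : ℕ) (σ : ℝ), 0 < σ →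
      ∀ (θ₀ : Fin n → ℝ)
        (S : Type) [Fintype S] [Nonempty S]
        [MeasurableSpace S] [MeasurableSingletonClass S]
        (H : S → Matrix (Fin n) (Fin n) ℝ)
        (sh : (Fin n → ℝ) → S), Measurable sh →
        (∀ y, SUREf σ H (sh y) y = ⨅ s, SUREf σ H s y) →
        ∀ (s₀ : S), (∀ s, riskR σ θ₀ H s₀ ≤ riskR σ θ₀ H s) →
        ∀ (r : ℝ), 1 ≤ r → riskR σ θ₀ H s₀ / σ ^ 2 ≤ r →
        ∀ (hop : ℝ), 1 ≤ hop → (∀ s, opNorm (H s) ≤ hop) →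
        edf n σ θ₀ H sh
          ≤ C * (Real.sqrt (r * Real.log (Fintype.card S))
             + hop * Real.log (Fintype.card S)
               * (1 + max 0 (Real.log (hop ^ 2 * Real.log (Fintype.card S) / r)))) := by
  refine ⟨67, by norm_num, ?_⟩
  intro n σ hσ θ₀ S _ _ _ _ H sh _ hsh s₀ _ r hr1 hr hop hop1 hH
  have hL : 0 ≤ Real.log (Fintype.card S) := Real.log_natCast_nonneg _
  have hbound : edf n σ θ₀ H sh
      ≤ (66 + 1) * (√(r * Real.log (Fintype.card S)) + hop * Real.log (Fintype.card S)) := by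
    refine le_of_forall_tradeoff (by linarith) hop1 hL (by norm_num) fun a ha ha1 hah => ?_
    rw [edf_eq_edf_one n hσ.ne']
    refine edf_one_le _ H _ s₀ (fun y => ?_) ((riskR_one_inv_smul hσ.ne' θ₀ H s₀).trans_le hr) hH
      (by linarith) ha ha1 hah
    have h := (hsh (σ • y)).trans_le (ciInf_le (Set.finite_range _).bddBelow s₀)
    rw [SUREf_smul, SUREf_smul] at h
    exact le_of_mul_le_mul_left h (by positivity)
  refine hbound.trans ?_
  norm_num1
  gcongr _ * (_ + ?_)
  exact le_mul_of_one_le_right (by positivity) (le_add_of_nonneg_right (le_max_left _ _))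
end

section
/- Let Z ~ N(0, Iₙ) be a standard Gaussian vector in ℝⁿ and A ∈ ℝ^{n×n} any matrix. Then the centered quadratic form ZᵀAZ − tr(A) is (tr((A + Aᵀ)²), 2‖A + Aᵀ‖_op)-sub-exponential: for all real λ with |λ| ≤ 1/(2‖A + Aᵀ‖_op), E[exp(λ(ZᵀAZ − tr(A)))] ≤ exp(λ² tr((A + Aᵀ)²)/2). -/
open MeasureTheory ProbabilityTheory Matrix Real

/-- The standard Gaussian measure `N(0, Iₙ)` on `ℝⁿ`. -/
noncomputable def stdGaussian (n : ℕ) : Measure (Fin n → ℝ) :=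
  Measure.pi fun _ : Fin n => gaussianReal 0 1

theorem one_le_one_sub_mul_exp {s : ℝ} (hs : |s| ≤ 1 / 2) :
    1 ≤ (1 - s) * rexp (s + s ^ 2) := by
  obtain ⟨h1, h2⟩ := abs_le.mp hs
  rcases le_total 0 s with h | h
  · have hq := quadratic_le_exp_of_nonneg (x := s + s ^ 2) (by positivity)
    have hm := mul_le_mul_of_nonneg_left hq (by linarith : 0 ≤ 1 - s)
    have hp : 0 ≤ (1 - s) * (1 + s) ^ 2 / 2 - s := by nlinarith [mul_nonneg h h]
    nlinarith [mul_nonneg (sq_nonneg s) hp]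
  · have hq := add_one_le_exp (s + s ^ 2)
    have hm := mul_le_mul_of_nonneg_left hq (by linarith : 0 ≤ 1 - s)
    nlinarith [mul_nonneg (sq_nonneg s) (neg_nonneg.mpr h)]

theorem integral_exp_half_mul_sq_sub_one (s : ℝ) :
    ∫ y, rexp (s / 2 * (y ^ 2 - 1)) ∂(gaussianReal 0 1) = rexp (-s / 2) * √(1 / (1 - s)) := by
  rw [integral_gaussianReal_eq_integral_smul one_ne_zero]
  have hfun (y : ℝ) : gaussianPDFReal 0 1 y • rexp (s / 2 * (y ^ 2 - 1)) =
      (√(2 * π))⁻¹ * rexp (-s / 2) * rexp (-((1 - s) / 2) * y ^ 2) := by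
    simp only [gaussianPDFReal, smul_eq_mul, NNReal.coe_one, mul_one, sub_zero]
    rw [mul_assoc, mul_assoc, ← exp_add, ← exp_add]
    ring_nf
  simp_rw [hfun]
  rw [integral_const_mul, integral_gaussian]
  have hsqrt : √(π / ((1 - s) / 2)) = √(2 * π) * √(1 / (1 - s)) := by
    rw [← sqrt_mul (by positivity)]
    rw [div_div_eq_mul_div, mul_one_div, mul_comm]
  rw [hsqrt]
  field_simp

theorem integral_exp_half_mul_sq_sub_one_le {s : ℝ} (hs : |s| ≤ 1 / 2) :
    ∫ y, rexp (s / 2 * (y ^ 2 - 1)) ∂(gaussianReal 0 1) ≤ rexp (s ^ 2 / 2) := by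
  have hpos : 0 < 1 - s := by linarith [(abs_le.mp hs).2]
  have hsqrt : √(1 / (1 - s)) ≤ rexp ((s + s ^ 2) / 2) := by
    rw [exp_half]
    exact sqrt_le_sqrt ((div_le_iff₀' hpos).mpr (one_le_one_sub_mul_exp hs))
  rw [integral_exp_half_mul_sq_sub_one]
  calc rexp (-s / 2) * √(1 / (1 - s)) ≤ rexp (-s / 2) * rexp ((s + s ^ 2) / 2) := by gcongr
    _ = rexp (s ^ 2 / 2) := by rw [← exp_add]; ring_nf

theorem integral_pi_gaussianReal_comp_orthonormalBasis {ι : Type*} [Fintype ι]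
    (b : OrthonormalBasis ι ℝ (EuclideanSpace ℝ ι)) {f : EuclideanSpace ℝ ι → ℝ}
    (hf : Continuous f) :
    ∫ z, f (WithLp.toLp 2 z) ∂(Measure.pi fun _ : ι => gaussianReal 0 1) =
      ∫ x, f (∑ i, x i • b i) ∂(Measure.pi fun _ : ι => gaussianReal 0 1) := by
  rw [← integral_map (φ := WithLp.toLp 2) (by fun_prop) hf.aestronglyMeasurable,
    map_pi_eq_stdGaussian, stdGaussian_eq_map_pi_orthonormalBasis b,
    integral_map (Measurable.aemeasurable (by fun_prop)) hf.aestronglyMeasurable]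

namespace Matrix.IsHermitian

variable {ι : Type*} [Fintype ι] [DecidableEq ι] {S : Matrix ι ι ℝ} (hS : S.IsHermitian)

theorem toEuclideanCLM_eigenvectorBasis (i : ι) :
    toEuclideanCLM (𝕜 := ℝ) S (hS.eigenvectorBasis i) =
      hS.eigenvalues i • hS.eigenvectorBasis i := by
  apply WithLp.ofLp_injective 2
  simpa using hS.mulVec_eigenvectorBasis i

theorem abs_eigenvalues_le_norm_toEuclideanCLM (i : ι) :
    |hS.eigenvalues i| ≤ ‖toEuclideanCLM (𝕜 := ℝ) S‖ := by
  have h := (toEuclideanCLM (𝕜 := ℝ) S).le_opNorm (hS.eigenvectorBasis i)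
  simpa [hS.toEuclideanCLM_eigenvectorBasis, norm_smul] using h

theorem inner_sum_smul_eigenvectorBasis (x : ι → ℝ) :
    inner ℝ (∑ i, x i • hS.eigenvectorBasis i)
      (toEuclideanCLM (𝕜 := ℝ) S (∑ i, x i • hS.eigenvectorBasis i)) =
      ∑ i, hS.eigenvalues i * x i ^ 2 := by
  simp only [map_sum, map_smul, hS.toEuclideanCLM_eigenvectorBasis, smul_smul]
  rw [hS.eigenvectorBasis.orthonormal.inner_sum]
  refine Finset.sum_congr rfl fun i _ => ?_
  simp only [conj_trivial]
  ring

theorem trace_mul_self_eq_sum_sq_eigenvalues :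
    (S * S).trace = ∑ i, hS.eigenvalues i ^ 2 := by
  conv_lhs => rw [hS.spectral_theorem, ← map_mul, Unitary.conjStarAlgAut_apply,
    trace_mul_cycle, Unitary.coe_star_mul_self, one_mul, diagonal_mul_diagonal, trace_diagonal]
  simp [sq]

/-- A bound on the moment generating function of a symmetric Gaussian quadratic form. -/
theorem integral_exp_half_mul_quadratic_le {l : ℝ}
    (hl : ∀ i, |l * hS.eigenvalues i| ≤ 1 / 2) :
    ∫ z, rexp (l / 2 * (z ⬝ᵥ S *ᵥ z - S.trace)) ∂(Measure.pi fun _ : ι => gaussianReal 0 1)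
      ≤ rexp (l ^ 2 * (S * S).trace / 2) := by
  have hrot := integral_pi_gaussianReal_comp_orthonormalBasis hS.eigenvectorBasis
    (f := fun w => rexp (l / 2 * (inner ℝ w (toEuclideanCLM (𝕜 := ℝ) S w) - S.trace)))
    (by fun_prop)
  simp only [hS.inner_sum_smul_eigenvectorBasis] at hrot
  simp only [inner_toEuclideanCLM] at hrot
  rw [hrot]
  have hprod (x : ι → ℝ) :
      rexp (l / 2 * (∑ i, hS.eigenvalues i * x i ^ 2 - S.trace)) =
        ∏ i, rexp (l * hS.eigenvalues i / 2 * (x i ^ 2 - 1)) := by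
    rw [← exp_sum, hS.trace_eq_sum_eigenvalues]
    simp only [RCLike.ofReal_real_eq_id, id_eq]
    rw [← Finset.sum_sub_distrib, Finset.mul_sum]
    congr 1
    exact Finset.sum_congr rfl fun i _ => by ring
  simp only [hprod]
  rw [integral_fintype_prod_eq_prod
    (f := fun i y => rexp (l * hS.eigenvalues i / 2 * (y ^ 2 - 1)))]
  calc ∏ i, ∫ y, rexp (l * hS.eigenvalues i / 2 * (y ^ 2 - 1)) ∂(gaussianReal 0 1)
      ≤ ∏ i, rexp ((l * hS.eigenvalues i) ^ 2 / 2) :=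
        Finset.prod_le_prod (fun i _ => integral_nonneg fun y => (exp_pos _).le)
          fun i _ => integral_exp_half_mul_sq_sub_one_le (hl i)
    _ = rexp (l ^ 2 * (S * S).trace / 2) := by
        rw [← exp_sum, hS.trace_mul_self_eq_sum_sq_eigenvalues, Finset.mul_sum, Finset.sum_div]
        simp only [mul_pow]

end Matrix.IsHermitian

theorem dotProduct_add_transpose_mulVec {ι : Type*} [Fintype ι] (A : Matrix ι ι ℝ) (z : ι → ℝ) :
    z ⬝ᵥ (A + Aᵀ) *ᵥ z = 2 * (z ⬝ᵥ A *ᵥ z) := by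
  rw [add_mulVec, dotProduct_add, mulVec_transpose, dotProduct_comm z (z ᵥ* A),
    ← dotProduct_mulVec]
  ring

/-- For `Z ~ N(0, Iₙ)` and any `A ∈ ℝ^{n×n}`, the centered quadratic
form `ZᵀAZ − tr A` is `(tr((A+Aᵀ)²), 2‖A+Aᵀ‖_op)`-sub-exponential. -/
theorem quadratic_form_subExponential (n : ℕ) (A : Matrix (Fin n) (Fin n) ℝ)
    (l : ℝ) (hl : |l| ≤ 1 / (2 * opNorm (A + Aᵀ))) :
    ∫ z, Real.exp (l * (z ⬝ᵥ A.mulVec z - A.trace)) ∂(stdGaussian n)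
      ≤ Real.exp (l ^ 2 * ((A + Aᵀ) * (A + Aᵀ)).trace / 2) := by
  have hS : (A + Aᵀ).IsHermitian := by
    rw [IsHermitian, conjTranspose_eq_transpose_of_trivial, transpose_add, transpose_transpose,
      add_comm]
  have hl' (i : Fin n) : |l * hS.eigenvalues i| ≤ 1 / 2 := by
    rw [abs_mul]
    have hnn : 0 ≤ opNorm (A + Aᵀ) := norm_nonneg _
    calc |l| * |hS.eigenvalues i| ≤ 1 / (2 * opNorm (A + Aᵀ)) * opNorm (A + Aᵀ) := by
          gcongr
          exact hS.abs_eigenvalues_le_norm_toEuclideanCLM i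
      _ = 1 / 2 * (opNorm (A + Aᵀ) / opNorm (A + Aᵀ)) := by ring
      _ ≤ 1 / 2 := by linarith [div_self_le_one (opNorm (A + Aᵀ))]
  refine le_of_eq_of_le ?_ (hS.integral_exp_half_mul_quadratic_le hl')
  refine integral_congr_ae (ae_of_all _ fun z => ?_)
  simp only [dotProduct_add_transpose_mulVec, trace_add, trace_transpose]
  ring_nf
end

section
/- Let Z ~ N(0, Iₙ) and let B ∈ ℝ^{n×n} be symmetric. Then for every real λ with |λ| ≤ 1/(4‖B‖_op), E[exp(λ(ZᵀBZ − tr(B)))] ≤ exp(2λ² tr(B²)). -/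
open MeasureTheory ProbabilityTheory Matrix Real

/-- A second-order lower bound for `exp`, equivalent to `-log (1 - t) ≤ t + t ^ 2`. -/
lemma one_le_one_sub_mul_exp_add_sq {t : ℝ} (ht : |t| ≤ 1 / 2) :
    1 ≤ (1 - t) * Real.exp (t + t ^ 2) := by
  obtain ⟨h1, h2⟩ := abs_le.mp ht
  rcases le_total 0 t with h | h
  · have hq := Real.quadratic_le_exp_of_nonneg (x := t + t ^ 2) (by positivity)
    have hpoly : 0 ≤ t ^ 2 * ((1 - t) * (1 + t) ^ 2 - 2 * t) := by
      refine mul_nonneg (sq_nonneg t) ?_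
      nlinarith [mul_nonneg h h, mul_nonneg h (sub_nonneg.mpr h2)]
    nlinarith [mul_le_mul_of_nonneg_left hq (by linarith : 0 ≤ 1 - t)]
  · have hq := Real.add_one_le_exp (t + t ^ 2)
    have hpoly : 0 ≤ -t * t ^ 2 := mul_nonneg (by linarith) (sq_nonneg t)
    nlinarith [mul_le_mul_of_nonneg_left hq (by linarith : 0 ≤ 1 - t)]

/-- The moment generating function of a centred chi-squared variable, one degree of freedom. -/
lemma integral_exp_mul_sq_sub_one_gaussianReal {a : ℝ} (ha : a < 1 / 2) :
    ∫ x, Real.exp (a * (x ^ 2 - 1)) ∂(gaussianReal 0 1) = Real.exp (-a) * (√(1 - 2 * a))⁻¹ := by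
  have hpos : 0 < 1 - 2 * a := by linarith
  have hdens : ∀ x : ℝ, gaussianPDFReal 0 1 x • Real.exp (a * (x ^ 2 - 1)) =
      ((√(2 * π))⁻¹ * Real.exp (-a)) * Real.exp (-(1 / 2 - a) * x ^ 2) := by
    intro x
    simp only [gaussianPDFReal, NNReal.coe_one, smul_eq_mul, mul_one, sub_zero]
    rw [mul_assoc, mul_assoc, ← Real.exp_add, ← Real.exp_add]
    ring_nf
  rw [integral_gaussianReal_eq_integral_smul one_ne_zero]
  simp_rw [hdens]
  rw [integral_const_mul, integral_gaussian,
    show π / (1 / 2 - a) = 2 * π / (1 - 2 * a) by field_simp,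
    Real.sqrt_div (by positivity)]
  have : √(2 * π) ≠ 0 := by positivity
  field_simp

lemma integral_exp_mul_sq_sub_one_gaussianReal_le {a : ℝ} (ha : |a| ≤ 1 / 4) :
    ∫ x, Real.exp (a * (x ^ 2 - 1)) ∂(gaussianReal 0 1) ≤ Real.exp (2 * a ^ 2) := by
  obtain ⟨-, h2⟩ := abs_le.mp ha
  have hpos : 0 < 1 - 2 * a := by linarith
  have key := one_le_one_sub_mul_exp_add_sq (t := 2 * a)
    (by rw [abs_mul, abs_two]; linarith)
  rw [integral_exp_mul_sq_sub_one_gaussianReal (by linarith), ← div_eq_mul_inv,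
    div_le_iff₀ (Real.sqrt_pos.mpr hpos), ← div_le_iff₀' (Real.exp_pos _), ← Real.exp_sub]
  refine Real.le_sqrt_of_sq_le ?_
  rw [← Real.exp_nat_mul, show ((2 : ℕ) : ℝ) * (-a - 2 * a ^ 2) = -(2 * a + (2 * a) ^ 2) by
    push_cast; ring, Real.exp_neg]
  exact inv_le_of_inv_le₀ hpos (by rwa [inv_le_iff_one_le_mul₀' hpos])

lemma abs_eigenvalues_le_opNorm {n : ℕ} {B : Matrix (Fin n) (Fin n) ℝ} (hB : B.IsHermitian)
    (i : Fin n) : |hB.eigenvalues i| ≤ opNorm B := by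
  have h := (Matrix.toEuclideanCLM (𝕜 := ℝ) B).le_opNorm (hB.eigenvectorBasis i)
  have hv : Matrix.toEuclideanCLM (𝕜 := ℝ) B (hB.eigenvectorBasis i) =
      hB.eigenvalues i • hB.eigenvectorBasis i := by
    apply WithLp.ofLp_injective 2
    simpa using hB.mulVec_eigenvectorBasis i
  simpa [hv, norm_smul, opNorm] using h

lemma Matrix.IsHermitian.trace_mul_self_eq_sum_eigenvalues_sq {n : ℕ}
    {B : Matrix (Fin n) (Fin n) ℝ} (hB : B.IsHermitian) :
    (B * B).trace = ∑ i, hB.eigenvalues i ^ 2 := by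
  conv_lhs => rw [hB.spectral_theorem, ← map_mul, Unitary.conjStarAlgAut_apply,
    Matrix.trace_mul_comm, ← mul_assoc]
  simp [Matrix.trace_diagonal, sq]

/-- A quadratic form of a symmetric matrix is diagonal in an orthonormal eigenbasis. -/
lemma Matrix.IsHermitian.dotProduct_mulVec_sum_eigenvectorBasis {n : ℕ}
    {B : Matrix (Fin n) (Fin n) ℝ} (hB : B.IsHermitian) (x : Fin n → ℝ) :
    (∑ i, x i • hB.eigenvectorBasis i).ofLp ⬝ᵥ
      B *ᵥ (∑ i, x i • hB.eigenvectorBasis i).ofLp = ∑ i, hB.eigenvalues i * x i ^ 2 := by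
  have hv : B *ᵥ (∑ i, x i • hB.eigenvectorBasis i).ofLp =
      (∑ i, (hB.eigenvalues i * x i) • hB.eigenvectorBasis i).ofLp := by
    simp only [WithLp.ofLp_sum, WithLp.ofLp_smul, Matrix.mulVec_sum, Matrix.mulVec_smul,
      hB.mulVec_eigenvectorBasis, smul_smul, mul_comm]
  have hinner := hB.eigenvectorBasis.orthonormal.inner_sum
    (fun i => hB.eigenvalues i * x i) x Finset.univ
  rw [hv]
  rw [EuclideanSpace.inner_eq_star_dotProduct] at hinner
  simpa [mul_assoc, sq, mul_comm, mul_left_comm] using hinner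

lemma integral_stdGaussian_eq_integral_sum_smul {n : ℕ}
    (b : OrthonormalBasis (Fin n) ℝ (EuclideanSpace ℝ (Fin n))) {f : (Fin n → ℝ) → ℝ}
    (hf : Continuous f) :
    ∫ z, f z ∂(stdGaussian n) = ∫ x, f (∑ i, x i • b i).ofLp ∂(stdGaussian n) := by
  have h := (map_pi_eq_stdGaussian (ι := Fin n)).trans (stdGaussian_eq_map_pi_orthonormalBasis b)
  have hg : Continuous fun v : EuclideanSpace ℝ (Fin n) => f v.ofLp := by fun_prop
  have h' := congrArg (fun μ => ∫ v, f v.ofLp ∂μ) h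
  simp only at h'
  rwa [integral_map (by fun_prop) hg.aestronglyMeasurable,
    integral_map (Measurable.aemeasurable (by fun_prop)) hg.aestronglyMeasurable] at h'

/-- For `Z ~ N(0, Iₙ)` and symmetric `B`, for every `λ` with
`|λ| ≤ 1/(4‖B‖_op)` one has `E[exp(λ(ZᵀBZ − tr B))] ≤ exp(2λ² tr(B²))`. -/
theorem symm_quadratic_form_mgf_bound (n : ℕ) (B : Matrix (Fin n) (Fin n) ℝ)
    (hB : B.IsSymm) (l : ℝ) (hl : |l| ≤ 1 / (4 * opNorm B)) :
    ∫ z, Real.exp (l * (z ⬝ᵥ B.mulVec z - B.trace)) ∂(stdGaussian n)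
      ≤ Real.exp (2 * l ^ 2 * (B * B).trace) := by
  have hH : B.IsHermitian := by simpa [Matrix.IsHermitian] using hB.eq
  have hsmall : ∀ i, |l * hH.eigenvalues i| ≤ 1 / 4 := by
    intro i
    have hop : 0 ≤ opNorm B := norm_nonneg _
    rw [abs_mul]
    refine (mul_le_mul hl (abs_eigenvalues_le_opNorm hH i) (abs_nonneg _) (by positivity)).trans ?_
    rcases hop.eq_or_lt with h0 | h0
    · simp [← h0]
    · exact le_of_eq (by field_simp)
  have htr : B.trace = ∑ i, hH.eigenvalues i := by
    simpa using hH.trace_eq_sum_eigenvalues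
  rw [integral_stdGaussian_eq_integral_sum_smul hH.eigenvectorBasis (by fun_prop)]
  have hprod : ∀ x : Fin n → ℝ,
      Real.exp (l * (∑ i, hH.eigenvalues i * x i ^ 2 - ∑ i, hH.eigenvalues i)) =
        ∏ i, Real.exp (l * hH.eigenvalues i * (x i ^ 2 - 1)) := by
    intro x
    rw [← Real.exp_sum, ← Finset.sum_sub_distrib, Finset.mul_sum]
    congr 1
    exact Finset.sum_congr rfl fun i _ => by ring
  simp_rw [hH.dotProduct_mulVec_sum_eigenvectorBasis, htr, hprod]
  rw [_root_.stdGaussian, integral_fintype_prod_eq_prod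
      (fun i x => Real.exp (l * hH.eigenvalues i * (x ^ 2 - 1))),
    hH.trace_mul_self_eq_sum_eigenvalues_sq, Finset.mul_sum, Real.exp_sum]
  refine Finset.prod_le_prod (fun i _ => integral_nonneg fun _ => (Real.exp_pos _).le) fun i _ => ?_
  refine (integral_exp_mul_sq_sub_one_gaussianReal_le (hsmall i)).trans_eq ?_
  ring_nf
end

section
/- Let Y = θ₀ + Z with Z ~ N(0, σ²Iₙ), σ > 0, and let {H_s}_{s∈S} be a finite collection of orthogonal projection matrices (H_s² = H_s = H_sᵀ). Suppose there exists s* ∈ S with H_{s*}θ₀ = θ₀, and let p_{s*} = tr(H_{s*}). Let ŝ(Y) be a measurable minimizer of SURE(s) = ‖Y − H_sY‖₂² + 2σ² tr(H_s), and let edf = E[(1/σ²)(H_{ŝ(Y)}Y)ᵀ(Y − θ₀) − tr(H_{ŝ(Y)})]. If p_{s*} ≥ 1, then there is a universal constant C such that edf ≤ C(√(p_{s*} log|S|) + log|S| · (1 + max{0, log(log|S| / p_{s*})})). -/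
open MeasureTheory ProbabilityTheory Matrix Real

lemma one_le_exp_mul_one_sub {x : ℝ} (h0 : 0 ≤ x) (h1 : x ≤ 1 / 2) :
    1 ≤ exp (x + x ^ 2) * (1 - x) := by
  have h := Real.quadratic_le_exp_of_nonneg (x := x + x ^ 2) (by positivity)
  calc 1 ≤ (1 + (x + x ^ 2) + (x + x ^ 2) ^ 2 / 2) * (1 - x) := by
        have : 0 ≤ x ^ 2 * (1 - (x + x ^ 2 + x ^ 3)) := by
          have : x ^ 2 ≤ 1 / 4 := by nlinarith
          have : x ^ 3 ≤ 1 / 8 := by nlinarith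
          apply mul_nonneg <;> nlinarith
        nlinarith
    _ ≤ _ := by gcongr; linarith

lemma gaussianReal_eq_withDensity_real :
    gaussianReal 0 1 = volume.withDensity (fun x => ENNReal.ofReal (gaussianPDFReal 0 1 x)) :=
  gaussianReal_of_var_ne_zero 0 one_ne_zero

lemma gaussianPDFReal_mul_exp_sq (a x : ℝ) :
    gaussianPDFReal 0 1 x * exp (a * x ^ 2) = (√(2 * π))⁻¹ * exp (-(1 / 2 - a) * x ^ 2) := by
  rw [gaussianPDFReal, mul_assoc, ← Real.exp_add]
  congr 2
  · simp
  · push_cast; ring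

lemma integrable_exp_mul_sq_gaussianReal {a : ℝ} (ha : a < 1 / 2) :
    Integrable (fun x => exp (a * x ^ 2)) (gaussianReal 0 1) := by
  rw [gaussianReal_eq_withDensity_real,
    integrable_withDensity_iff_integrable_smul' (by fun_prop) (by simp)]
  have : (fun x => (ENNReal.ofReal (gaussianPDFReal 0 1 x)).toReal • exp (a * x ^ 2)) =
      fun x => (√(2 * π))⁻¹ * exp (-(1 / 2 - a) * x ^ 2) := by
    ext x
    rw [ENNReal.toReal_ofReal (gaussianPDFReal_nonneg _ _ _), smul_eq_mul,
      gaussianPDFReal_mul_exp_sq]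
  rw [this]
  exact (integrable_exp_neg_mul_sq (by linarith)).const_mul _

lemma integral_exp_mul_sq_gaussianReal {a : ℝ} (ha : a < 1 / 2) :
    ∫ x, exp (a * x ^ 2) ∂(gaussianReal 0 1) = (√(1 - 2 * a))⁻¹ := by
  rw [integral_gaussianReal_eq_integral_smul one_ne_zero]
  simp_rw [smul_eq_mul, gaussianPDFReal_mul_exp_sq]
  rw [integral_const_mul, integral_gaussian, ← Real.sqrt_inv, ← Real.sqrt_inv,
    ← Real.sqrt_mul (by positivity)]
  congr 1
  have : 1 - 2 * a ≠ 0 := by linarith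
  have : 1 / 2 - a ≠ 0 := by linarith
  have := Real.pi_ne_zero
  field_simp

lemma integral_exp_mul_sq_gaussianReal_le {a : ℝ} (h0 : 0 ≤ a) (h1 : a ≤ 1 / 4) :
    ∫ x, exp (a * x ^ 2) ∂(gaussianReal 0 1) ≤ exp (a + 2 * a ^ 2) := by
  rw [integral_exp_mul_sq_gaussianReal (by linarith), inv_le_iff_one_le_mul₀
    (Real.sqrt_pos.2 (by linarith)), ← Real.sqrt_sq (exp_nonneg _), ← Real.sqrt_mul (by positivity),
    Real.one_le_sqrt, ← Real.exp_nat_mul]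
  refine (one_le_exp_mul_one_sub (x := 2 * a) (by linarith) (by linarith)).trans_eq ?_
  congr 2
  push_cast; ring

lemma integral_exp_mul_gaussianReal (a : ℝ) :
    ∫ x, exp (a * x) ∂(gaussianReal 0 1) = exp (a ^ 2 / 2) := by
  have := congrFun (mgf_id_gaussianReal (μ := 0) (v := 1)) a
  simpa [mgf] using this

/-- Maximal inequality: a data-driven choice among finitely many variables whose exponential
moments are at most one has expectation at most the logarithm of their number. -/
lemma integral_selected_le_log_card {Ω S : Type*} [MeasurableSpace Ω] {P : Measure Ω}
    [IsProbabilityMeasure P] [Fintype S] [Nonempty S] {f : S → Ω → ℝ} {t : Ω → S}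
    (hf : Integrable (fun ω => f (t ω) ω) P)
    (hexp : ∀ s, Integrable (fun ω => exp (f s ω)) P) (hle : ∀ s, ∫ ω, exp (f s ω) ∂P ≤ 1) :
    ∫ ω, f (t ω) ω ∂P ≤ Real.log (Fintype.card S) := by
  have hN : (0 : ℝ) < Fintype.card S := by exact_mod_cast Fintype.card_pos
  have hsumint : Integrable (fun ω => (Fintype.card S : ℝ)⁻¹ * ∑ s, exp (f s ω)) P :=
    (integrable_finsetSum _ fun s _ => hexp s).const_mul _
  have hpt : ∀ ω, f (t ω) ω ≤ (Real.log (Fintype.card S) - 1) +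
      (Fintype.card S : ℝ)⁻¹ * ∑ s, exp (f s ω) := fun ω => by
    have h := Real.add_one_le_exp (f (t ω) ω - Real.log (Fintype.card S))
    rw [Real.exp_sub, Real.exp_log hN, div_eq_inv_mul] at h
    have : (Fintype.card S : ℝ)⁻¹ * exp (f (t ω) ω) ≤
        (Fintype.card S : ℝ)⁻¹ * ∑ s, exp (f s ω) := by
      gcongr
      exact Finset.single_le_sum (f := fun s => exp (f s ω)) (fun _ _ => (exp_pos _).le)
        (Finset.mem_univ _)
    linarith
  have hint := integral_mono hf ((integrable_const _).add hsumint) hpt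
  have hsum : ∑ s, ∫ ω, exp (f s ω) ∂P ≤ Fintype.card S := by
    simpa using Finset.sum_le_sum fun s (_ : s ∈ Finset.univ) => hle s
  simp only [Pi.add_apply] at hint
  rw [integral_add (integrable_const _) hsumint, integral_const_mul,
    integral_finsetSum _ fun s _ => hexp s, integral_const, probReal_univ, one_smul] at hint
  have : (Fintype.card S : ℝ)⁻¹ * ∑ s, ∫ ω, exp (f s ω) ∂P ≤ 1 := by
    rw [inv_mul_le_iff₀ hN]; simpa using hsum
  linarith

lemma integrable_selected {Ω S : Type*} [MeasurableSpace Ω] {P : Measure Ω} [Fintype S]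
    [MeasurableSpace S] [MeasurableSingletonClass S] {f : S → Ω → ℝ} {t : Ω → S}
    (ht : Measurable t) (hf : ∀ s, Integrable (f s) P) :
    Integrable (fun ω => f (t ω) ω) P := by
  classical
  have : (fun ω => f (t ω) ω) = fun ω => ∑ s, (t ⁻¹' {s}).indicator (f s) ω := by
    ext ω
    simp [Set.indicator_apply]
  rw [this]
  exact integrable_finsetSum _ fun s _ => (hf s).indicator (ht (measurableSet_singleton s))

/-- The standard Gaussian measure on `ℝⁿ`. -/
noncomputable abbrev stdGaussianPi (n : ℕ) : Measure (Fin n → ℝ) :=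
  Measure.pi fun _ => gaussianReal 0 1

lemma gaussianVec_eq_map_smul (n : ℕ) (σ : ℝ) :
    gaussianVec n σ = (stdGaussianPi n).map (fun x => σ • x) := by
  have hmap : (gaussianReal 0 1).map (σ * ·) = gaussianReal 0 (σ ^ 2).toNNReal := by
    rw [gaussianReal_map_const_mul]
    congr 1
    · simp
    · ext; simp [sq_nonneg]
  have : ∀ _ : Fin n, SigmaFinite ((gaussianReal 0 1).map (σ * ·)) := fun _ => by
    rw [hmap]; infer_instance
  change _ = (Measure.pi fun _ => gaussianReal 0 1).map (fun x i => σ * x i)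
  rw [Measure.pi_map_pi (f := fun _ x => σ * x) (fun _ => by fun_prop)]
  simp only [hmap, gaussianVec]

lemma stdGaussianPi_eq_map_orthonormalBasis {n : ℕ}
    (b : OrthonormalBasis (Fin n) ℝ (EuclideanSpace ℝ (Fin n))) :
    stdGaussianPi n =
      (stdGaussianPi n).map (fun x => ∑ i, x i • (b i : Fin n → ℝ)) := by
  have h := (map_pi_eq_stdGaussian (ι := Fin n)).trans (stdGaussian_eq_map_pi_orthonormalBasis b)
  have h' := congrArg (Measure.map (WithLp.ofLp : EuclideanSpace ℝ (Fin n) → Fin n → ℝ)) h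
  rw [Measure.map_map (by fun_prop) (by fun_prop), Measure.map_map (by fun_prop) (by fun_prop)] at h'
  convert h' using 1
  · exact (Measure.map_id).symm
  · congr 1
    ext x j
    simp

/-- An orthogonal projector is diagonal, with eigenvalues `0` and `1`, in some orthonormal basis. -/
lemma exists_orthonormal_diagonalization {n : ℕ} {H : Matrix (Fin n) (Fin n) ℝ}
    (hH : H * H = H) (hs : H.IsSymm) :
    ∃ (b : OrthonormalBasis (Fin n) ℝ (EuclideanSpace ℝ (Fin n))) (h : Fin n → ℝ),
      (∀ i, h i = 0 ∨ h i = 1) ∧ (∀ i, H *ᵥ (b i : Fin n → ℝ) = h i • (b i : Fin n → ℝ)) ∧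
      H.trace = ∑ i, h i := by
  have hA : H.IsHermitian := by
    rw [Matrix.IsHermitian, conjTranspose_eq_transpose_of_trivial]; exact hs
  refine ⟨hA.eigenvectorBasis, hA.eigenvalues, fun i => ?_, hA.mulVec_eigenvectorBasis, by
    simpa using hA.trace_eq_sum_eigenvalues⟩
  have he := hA.mulVec_eigenvectorBasis i
  have h2 : H *ᵥ (H *ᵥ (hA.eigenvectorBasis i : Fin n → ℝ)) = H *ᵥ hA.eigenvectorBasis i := by
    rw [mulVec_mulVec, hH]
  rw [he, mulVec_smul, he, smul_smul, ← sub_eq_zero, ← sub_smul] at h2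
  have hne : (hA.eigenvectorBasis i : Fin n → ℝ) ≠ 0 := fun h0 => by
    apply hA.eigenvectorBasis.orthonormal.ne_zero i
    ext j
    simpa using congrFun h0 j
  have := (smul_eq_zero.1 h2).resolve_right hne
  rcases mul_eq_zero.1 (show hA.eigenvalues i * (hA.eigenvalues i - 1) = 0 by linarith) with h | h
  · exact Or.inl h
  · exact Or.inr (by linarith)

/-- Exponential moment of the quadratic form of a projector plus an orthogonal linear form. -/
lemma integral_exp_quadratic_le {n : ℕ} {H : Matrix (Fin n) (Fin n) ℝ}
    (hH : H * H = H) (hs : H.IsSymm) {v : Fin n → ℝ} (hv : H *ᵥ v = 0) {a : ℝ}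
    (h0 : 0 ≤ a) (h1 : a ≤ 1 / 4) :
    Integrable (fun x => exp (a * (x ⬝ᵥ H *ᵥ x) + v ⬝ᵥ x)) (stdGaussianPi n) ∧
    ∫ x, exp (a * (x ⬝ᵥ H *ᵥ x) + v ⬝ᵥ x) ∂(stdGaussianPi n) ≤
      exp ((a + 2 * a ^ 2) * H.trace + v ⬝ᵥ v / 2) := by
  obtain ⟨b, h, h01, hb, htr⟩ := exists_orthonormal_diagonalization hH hs
  set w : Fin n → ℝ := fun i => v ⬝ᵥ (b i : Fin n → ℝ) with hw
  have hbb : ∀ i j, (b i : Fin n → ℝ) ⬝ᵥ (b j : Fin n → ℝ) = if i = j then 1 else 0 := fun i j => by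
    have := orthonormal_iff_ite.1 b.orthonormal j i
    rw [EuclideanSpace.inner_eq_star_dotProduct] at this
    simpa [eq_comm] using this
  have hvv : v ⬝ᵥ v = ∑ i, w i ^ 2 := by
    have := b.sum_sq_inner_right (WithLp.toLp 2 v)
    simp only [EuclideanSpace.inner_eq_star_dotProduct, EuclideanSpace.real_norm_sq_eq] at this
    simp only [hw]
    rw [dotProduct]
    simpa [pow_two] using this.symm
  have hwh : ∀ i, h i = 0 ∨ w i = 0 := fun i => by
    have : v ⬝ᵥ H *ᵥ (b i : Fin n → ℝ) = 0 := by
      rw [dotProduct_mulVec, ← mulVec_transpose, hs.eq, hv, zero_dotProduct]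
    rw [hb, dotProduct_smul, smul_eq_mul] at this
    exact mul_eq_zero.1 this
  have hquad : ∀ x : Fin n → ℝ, a * ((∑ i, x i • (b i : Fin n → ℝ)) ⬝ᵥ
      H *ᵥ (∑ i, x i • (b i : Fin n → ℝ))) + v ⬝ᵥ (∑ i, x i • (b i : Fin n → ℝ)) =
      ∑ i, (a * h i * x i ^ 2 + w i * x i) := fun x => by
    simp only [mulVec_sum, mulVec_smul, hb, dotProduct_sum, sum_dotProduct, dotProduct_smul,
      smul_dotProduct, hbb, smul_eq_mul]
    simp only [mul_ite, mul_one, mul_zero, Finset.sum_ite_eq', Finset.mem_univ, if_true,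
      Finset.mul_sum, ← Finset.sum_add_distrib]
    refine Finset.sum_congr rfl fun i _ => ?_
    simp [hw]
    ring
  have hone : ∀ i, Integrable (fun y => exp (a * h i * y ^ 2 + w i * y)) (gaussianReal 0 1) ∧
      ∫ y, exp (a * h i * y ^ 2 + w i * y) ∂(gaussianReal 0 1) ≤
        exp ((a + 2 * a ^ 2) * h i + w i ^ 2 / 2) := fun i => by
    rcases hwh i with hi | hi
    · simp only [hi, mul_zero, zero_mul, zero_add]
      exact ⟨integrable_exp_mul_gaussianReal _, (integral_exp_mul_gaussianReal _).le⟩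
    · rcases h01 i with hi' | hi'
      · simp [hi, hi']
      · simp only [hi, hi', mul_one, zero_mul, add_zero, ne_eq, OfNat.ofNat_ne_zero,
          not_false_eq_true, zero_pow, zero_div]
        exact ⟨integrable_exp_mul_sq_gaussianReal (by linarith),
          integral_exp_mul_sq_gaussianReal_le h0 h1⟩
  have hcomp : ∀ x : Fin n → ℝ, exp (a * ((∑ i, x i • (b i : Fin n → ℝ)) ⬝ᵥ
      H *ᵥ (∑ i, x i • (b i : Fin n → ℝ))) + v ⬝ᵥ (∑ i, x i • (b i : Fin n → ℝ))) =
      ∏ i, exp (a * h i * x i ^ 2 + w i * x i) := fun x => by rw [hquad, Real.exp_sum]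
  have hmeas : Continuous (fun x : Fin n → ℝ => exp (a * (x ⬝ᵥ H *ᵥ x) + v ⬝ᵥ x)) := by
    fun_prop
  have hlin : Continuous (fun x : Fin n → ℝ => ∑ i, x i • (b i : Fin n → ℝ)) := by fun_prop
  rw [stdGaussianPi_eq_map_orthonormalBasis b]
  rw [integrable_map_measure hmeas.aestronglyMeasurable hlin.aemeasurable,
    integral_map hlin.aemeasurable hmeas.aestronglyMeasurable]
  simp only [Function.comp_def, hcomp]
  refine ⟨Integrable.fintype_prod fun i => (hone i).1, ?_⟩
  rw [integral_fintype_prod_eq_prod (𝕜 := ℝ)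
    (f := fun i y => exp (a * h i * y ^ 2 + w i * y)), htr, hvv, Finset.mul_sum, Finset.sum_div,
    ← Finset.sum_add_distrib, Real.exp_sum]
  exact Finset.prod_le_prod (fun i _ => integral_nonneg fun _ => (exp_pos _).le)
    fun i _ => (hone i).2

lemma integrable_dotProduct_stdGaussianPi {n : ℕ} (v : Fin n → ℝ) :
    Integrable (fun x => v ⬝ᵥ x) (stdGaussianPi n) := by
  simp only [dotProduct]
  refine integrable_finsetSum _ fun i _ => Integrable.const_mul ?_ _
  exact integrable_comp_eval (f := id) ((memLp_id_gaussianReal 1).integrable le_rfl)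

lemma integral_dotProduct_stdGaussianPi {n : ℕ} (v : Fin n → ℝ) :
    ∫ x, v ⬝ᵥ x ∂(stdGaussianPi n) = 0 := by
  simp only [dotProduct]
  rw [integral_finsetSum]
  · refine Finset.sum_eq_zero fun i _ => ?_
    rw [integral_const_mul, integral_comp_eval (i := i) (μ := fun _ : Fin n => gaussianReal 0 1)
      (f := fun x : ℝ => x) (by fun_prop)]
    simp
  · exact fun i _ => (integrable_comp_eval (f := id)
      ((memLp_id_gaussianReal 1).integrable le_rfl)).const_mul _

lemma integrable_quadratic_stdGaussianPi {n : ℕ} (H : Matrix (Fin n) (Fin n) ℝ) :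
    Integrable (fun x => x ⬝ᵥ H *ᵥ x) (stdGaussianPi n) := by
  have hL (i : Fin n) : MemLp (fun x : Fin n → ℝ => x i) 2 (stdGaussianPi n) :=
    (memLp_id_gaussianReal 2).comp_measurePreserving (measurePreserving_eval _ i)
  simp only [dotProduct, mulVec, Finset.mul_sum]
  refine integrable_finsetSum _ fun i _ => integrable_finsetSum _ fun j _ => ?_
  have := ((hL i).integrable_mul (hL j)).const_mul (H i j)
  refine this.congr (ae_of_all _ fun x => ?_)
  simp only [Pi.mul_apply]
  ring

/-- The noise `xᵀHx − tr H − c vᵀx` with `v = (I − H)η`, the bias of the projector `H` at `η`. -/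
noncomputable def projNoise {n : ℕ} (H : Matrix (Fin n) (Fin n) ℝ) (η : Fin n → ℝ) (c : ℝ)
    (x : Fin n → ℝ) : ℝ :=
  x ⬝ᵥ H *ᵥ x - H.trace - c * ((η - H *ᵥ η) ⬝ᵥ x)

/-- The risk `‖(I − H)η‖² + tr H` of the projection estimator at unit noise level. -/
noncomputable def projRisk {n : ℕ} (H : Matrix (Fin n) (Fin n) ℝ) (η : Fin n → ℝ) : ℝ :=
  (η - H *ᵥ η) ⬝ᵥ (η - H *ᵥ η) + H.trace

section Projector

variable {n : ℕ} {H : Matrix (Fin n) (Fin n) ℝ}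

lemma integrable_projNoise (H : Matrix (Fin n) (Fin n) ℝ) (η : Fin n → ℝ) (c : ℝ) :
    Integrable (projNoise H η c) (stdGaussianPi n) :=
  ((integrable_quadratic_stdGaussianPi H).sub (integrable_const _)).sub
    ((integrable_dotProduct_stdGaussianPi _).const_mul c)

lemma mulVec_sub_mulVec_self (hH : H * H = H) (η : Fin n → ℝ) : H *ᵥ (η - H *ᵥ η) = 0 := by
  rw [mulVec_sub, mulVec_mulVec, hH, sub_self]

lemma dotProduct_mulVec_self_eq (hH : H * H = H) (hs : H.IsSymm) (x : Fin n → ℝ) :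
    (H *ᵥ x) ⬝ᵥ (H *ᵥ x) = x ⬝ᵥ H *ᵥ x := by
  rw [dotProduct_mulVec, ← mulVec_transpose, hs.eq, mulVec_mulVec, hH, dotProduct_comm]

/-- Expansion of the residual sum of squares of `y = η + x` in terms of risk and noise. -/
lemma residual_add_two_trace (hH : H * H = H) (hs : H.IsSymm) (η x : Fin n → ℝ) :
    (η + x - H *ᵥ (η + x)) ⬝ᵥ (η + x - H *ᵥ (η + x)) + 2 * H.trace =
      x ⬝ᵥ x + projRisk H η - projNoise H η 2 x := by
  have hv : (η - H *ᵥ η) ⬝ᵥ (H *ᵥ x) = 0 := by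
    rw [dotProduct_mulVec, ← mulVec_transpose, hs.eq, mulVec_sub_mulVec_self hH, zero_dotProduct]
  have hsplit : η + x - H *ᵥ (η + x) = (η - H *ᵥ η) + (x - H *ᵥ x) := by
    rw [mulVec_add]; abel
  rw [hsplit, projRisk, projNoise]
  generalize η - H *ᵥ η = v at hv ⊢
  simp only [add_dotProduct, dotProduct_add, dotProduct_sub, sub_dotProduct,
    dotProduct_mulVec_self_eq hH hs, dotProduct_comm x v, dotProduct_comm (H *ᵥ x) v, hv,
    dotProduct_comm (H *ᵥ x) x]
  ring

lemma integral_exp_projNoise_le_one (hH : H * H = H) (hs : H.IsSymm) (η : Fin n → ℝ)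
    {c a : ℝ} (hc : c ^ 2 ≤ 4) (h0 : 0 ≤ a) (h1 : a ≤ 1 / 4) :
    Integrable (fun x => exp (a * (projNoise H η c x - 2 * a * projRisk H η)))
      (stdGaussianPi n) ∧
    ∫ x, exp (a * (projNoise H η c x - 2 * a * projRisk H η)) ∂(stdGaussianPi n) ≤ 1 := by
  set v := η - H *ᵥ η with hv
  have hHv : H *ᵥ ((-(a * c)) • v) = 0 := by
    rw [mulVec_smul, hv, mulVec_sub_mulVec_self hH, smul_zero]
  obtain ⟨hi, hle⟩ := integral_exp_quadratic_le hH hs hHv h0 h1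
  have heq : ∀ x, exp (a * (projNoise H η c x - 2 * a * projRisk H η)) =
      exp (-(a * H.trace + 2 * a ^ 2 * projRisk H η)) *
        exp (a * (x ⬝ᵥ H *ᵥ x) + ((-(a * c)) • v) ⬝ᵥ x) := fun x => by
    rw [← Real.exp_add, projNoise, ← hv, smul_dotProduct, smul_eq_mul]
    congr 1
    ring
  simp only [heq]
  refine ⟨hi.const_mul _, ?_⟩
  rw [integral_const_mul]
  refine (mul_le_mul_of_nonneg_left hle (exp_pos _).le).trans ?_
  rw [← Real.exp_add, Real.exp_le_one_iff, projRisk, ← hv]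
  simp only [smul_dotProduct, dotProduct_smul, smul_eq_mul]
  have hvv : 0 ≤ v ⬝ᵥ v := by
    simpa using dotProduct_star_self_nonneg v
  have : a ^ 2 * (v ⬝ᵥ v) * c ^ 2 ≤ a ^ 2 * (v ⬝ᵥ v) * 4 := by gcongr
  linarith

end Projector

section Selection

variable {n : ℕ} {S : Type*} [Fintype S] [Nonempty S] [MeasurableSpace S]
  [MeasurableSingletonClass S] {H : S → Matrix (Fin n) (Fin n) ℝ} {t : (Fin n → ℝ) → S}

lemma mul_integral_selected_projNoise_le (hH : ∀ s, H s * H s = H s) (hs : ∀ s, (H s).IsSymm)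
    (ht : Measurable t) (η : Fin n → ℝ) {c a : ℝ} (hc : c ^ 2 ≤ 4) (h0 : 0 ≤ a) (h1 : a ≤ 1 / 4) :
    a * (∫ x, projNoise (H (t x)) η c x ∂(stdGaussianPi n) -
      2 * a * ∫ x, projRisk (H (t x)) η ∂(stdGaussianPi n)) ≤ Real.log (Fintype.card S) := by
  have hW : Integrable (fun x => projNoise (H (t x)) η c x) (stdGaussianPi n) :=
    integrable_selected (f := fun s => projNoise (H s) η c) ht
      fun s => integrable_projNoise (H s) η c
  have hR : Integrable (fun x => projRisk (H (t x)) η) (stdGaussianPi n) :=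
    integrable_selected (f := fun s _ => projRisk (H s) η) ht fun s => integrable_const _
  have := integral_selected_le_log_card (P := stdGaussianPi n) (t := t)
    (f := fun s x => a * (projNoise (H s) η c x - 2 * a * projRisk (H s) η))
    ((hW.sub (hR.const_mul _)).const_mul _)
    (fun s => (integral_exp_projNoise_le_one (hH s) (hs s) η hc h0 h1).1)
    (fun s => (integral_exp_projNoise_le_one (hH s) (hs s) η hc h0 h1).2)
  rwa [integral_const_mul, integral_sub hW (hR.const_mul _), integral_const_mul] at this

/-- If `t` minimizes the unit-noise SURE criterion and some projector fixes `η`, the expected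
noise of the selected projector is at most of order `√(p L) + L` with `L = log |S|`. -/
lemma integral_selected_projNoise_le (hH : ∀ s, H s * H s = H s) (hs : ∀ s, (H s).IsSymm)
    (ht : Measurable t) {η : Fin n → ℝ} {s₀ : S} (hη : H s₀ *ᵥ η = η) (hp : 0 ≤ (H s₀).trace)
    (hmin : ∀ x, projRisk (H (t x)) η - projNoise (H (t x)) η 2 x ≤
      projRisk (H s₀) η - projNoise (H s₀) η 2 x) :
    ∫ x, projNoise (H (t x)) η 1 x ∂(stdGaussianPi n) ≤
      8 * (√((H s₀).trace * Real.log (Fintype.card S)) + Real.log (Fintype.card S)) := by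
  set p := (H s₀).trace
  set L := Real.log (Fintype.card S)
  have hL : 0 ≤ L := Real.log_natCast_nonneg _
  have hD : Integrable (fun x => projNoise (H (t x)) η 2 x) (stdGaussianPi n) :=
    integrable_selected (f := fun s => projNoise (H s) η 2) ht
      fun s => integrable_projNoise (H s) η 2
  have hR : Integrable (fun x => projRisk (H (t x)) η) (stdGaussianPi n) :=
    integrable_selected (f := fun s _ => projRisk (H s) η) ht fun s => integrable_const _
  have hpt : ∀ x, projRisk (H (t x)) η ≤ 2 * p + projNoise (H (t x)) η 2 x := fun x => by
    have hq : 0 ≤ x ⬝ᵥ H s₀ *ᵥ x := by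
      rw [← dotProduct_mulVec_self_eq (hH s₀) (hs s₀)]
      simpa using dotProduct_star_self_nonneg (H s₀ *ᵥ x)
    have := hmin x
    have e1 : projRisk (H s₀) η = p := by simp [projRisk, hη, p]
    have e2 : projNoise (H s₀) η 2 x = x ⬝ᵥ H s₀ *ᵥ x - p := by simp [projNoise, hη, p]
    linarith
  have hER := integral_mono hR ((integrable_const (2 * p)).add hD) hpt
  simp only [Pi.add_apply] at hER
  rw [integral_add (integrable_const _) hD, integral_const, probReal_univ, one_smul] at hER
  have hquarter := mul_integral_selected_projNoise_le hH hs ht η (c := 2) (a := 1 / 4)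
    (by norm_num) (by norm_num) le_rfl
  have hbound : ∫ x, projRisk (H (t x)) η ∂(stdGaussianPi n) ≤ 8 * (p + L) := by linarith
  have hkey : ∀ a : ℝ, 0 < a → a ≤ 1 / 4 →
      a * ∫ x, projNoise (H (t x)) η 1 x ∂(stdGaussianPi n) ≤ L + 16 * a ^ 2 * (p + L) := by
    intro a h0 h1
    have := mul_integral_selected_projNoise_le hH hs ht η (c := 1) (by norm_num) h0.le h1
    nlinarith [mul_le_mul_of_nonneg_left hbound (sq_nonneg a)]
  generalize ∫ x, projNoise (H (t x)) η 1 x ∂(stdGaussianPi n) = E at hkey ⊢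
  rcases hL.eq_or_lt with hL0 | hL0
  · rw [← hL0] at hkey ⊢
    simp only [mul_zero, Real.sqrt_zero, add_zero]
    by_contra! hE
    set a := min (1 / 4) (E / (32 * (p + 1)))
    have ha0 : 0 < a := lt_min (by norm_num) (by positivity)
    have ha1 : a * (32 * (p + 1)) ≤ E := by
      rw [← le_div_iff₀ (by positivity)]; exact min_le_right _ _
    have := hkey a ha0 (min_le_left _ _)
    nlinarith [mul_le_mul_of_nonneg_left ha1 ha0.le, sq_nonneg a, mul_pos ha0 ha0,
      mul_nonneg (sq_nonneg a) hp]
  · set r := √(L / (p + L)) with hr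
    have hpL : 0 < p + L := by linarith
    have hr0 : 0 < r := Real.sqrt_pos.2 (by positivity)
    have hr1 : r ≤ 1 := Real.sqrt_le_one.2 (by rw [div_le_one hpL]; linarith)
    have hr2 : r ^ 2 * (p + L) = L := by
      rw [hr, Real.sq_sqrt (by positivity)]; field_simp
    have h := hkey (r / 4) (by positivity) (by linarith)
    have hrE : r * E ≤ 8 * (r * (r * (p + L))) := by nlinarith
    have hE := le_of_mul_le_mul_left (hrE.trans_eq (by ring : _ = r * (8 * (r * (p + L))))) hr0
    have hsum : r * (p + L) ≤ √(p * L) + L := by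
      have hsq : (r * (p + L)) ^ 2 = p * L + L ^ 2 := by
        calc (r * (p + L)) ^ 2 = r ^ 2 * (p + L) * (p + L) := by ring
          _ = p * L + L ^ 2 := by rw [hr2]; ring
      refine abs_le_of_sq_le_sq' ?_ (by positivity) |>.2
      rw [hsq]
      nlinarith [Real.sq_sqrt (mul_nonneg hp hL), Real.sqrt_nonneg (p * L)]
    linarith

end Selection

lemma edf_eq_integral_projNoise {n : ℕ} {σ : ℝ} (hσ : 0 < σ) (θ₀ : Fin n → ℝ) {S : Type}
    [Fintype S] [MeasurableSpace S] [MeasurableSingletonClass S]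
    (H : S → Matrix (Fin n) (Fin n) ℝ)
    {sh : (Fin n → ℝ) → S} (hsh : Measurable sh) :
    edf n σ θ₀ H sh =
      ∫ x, projNoise (H (sh (θ₀ + σ • x))) (σ⁻¹ • θ₀) 1 x ∂(stdGaussianPi n) := by
  have ht : Measurable fun x : Fin n → ℝ => sh (θ₀ + σ • x) := hsh.comp (by fun_prop)
  have hemb : MeasurableEmbedding (fun x : Fin n → ℝ => σ • x) :=
    (Homeomorph.smulOfNeZero σ hσ.ne').measurableEmbedding
  rw [edf, gaussianVec_eq_map_smul, hemb.integral_map]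
  have hpt : ∀ x : Fin n → ℝ, 1 / σ ^ 2 *
      ((H (sh (θ₀ + σ • x))) *ᵥ (θ₀ + σ • x) ⬝ᵥ (σ • x)) - (H (sh (θ₀ + σ • x))).trace =
      projNoise (H (sh (θ₀ + σ • x))) (σ⁻¹ • θ₀) 1 x + (σ⁻¹ • θ₀) ⬝ᵥ x := fun x => by
    simp only [projNoise, mulVec_add, mulVec_smul, add_dotProduct, sub_dotProduct,
      smul_dotProduct, dotProduct_smul, smul_eq_mul, dotProduct_comm x]
    field_simp
    ring
  simp only [hpt]
  rw [integral_add (integrable_selected (f := fun s => projNoise (H s) (σ⁻¹ • θ₀) 1) ht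
    fun s => integrable_projNoise (H s) _ 1) (integrable_dotProduct_stdGaussianPi _),
    integral_dotProduct_stdGaussianPi, add_zero]

lemma SUREf_add_smul {n : ℕ} {σ : ℝ} (hσ : 0 < σ) (θ₀ x : Fin n → ℝ) {S : Type}
    {H : S → Matrix (Fin n) (Fin n) ℝ} {s : S} (hH : H s * H s = H s) (hs : (H s).IsSymm) :
    SUREf σ H s (θ₀ + σ • x) =
      σ ^ 2 * (x ⬝ᵥ x + projRisk (H s) (σ⁻¹ • θ₀) - projNoise (H s) (σ⁻¹ • θ₀) 2 x) := by
  have hy : θ₀ + σ • x = σ • (σ⁻¹ • θ₀ + x) := by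
    rw [smul_add, smul_smul, mul_inv_cancel₀ hσ.ne', one_smul]
  rw [← residual_add_two_trace hH hs, SUREf, hy, mulVec_smul, mul_add, dotProduct,
    Finset.mul_sum]
  congr 1
  · refine Finset.sum_congr rfl fun i _ => ?_
    simp only [Pi.smul_apply, Pi.sub_apply, smul_eq_mul]
    ring
  · ring

/-- for SURE-tuned projection (subset-regression) estimators with a
true model `s*` (`H_{s*}θ₀ = θ₀`, `p_{s*} = tr(H_{s*}) ≥ 1`), the excess degrees
of freedom satisfies
`edf ≤ C(√(p_{s*} log|S|) + log|S|(1 + log₊(log|S| / p_{s*})))`. -/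
theorem edf_bound_projection_true_model :
    ∃ C : ℝ, 0 < C ∧
      ∀ (n : ℕ) (σ : ℝ), 0 < σ →
      ∀ (θ₀ : Fin n → ℝ)
        (S : Type) [Fintype S] [Nonempty S]
        [MeasurableSpace S] [MeasurableSingletonClass S]
        (H : S → Matrix (Fin n) (Fin n) ℝ),
        (∀ s, H s * H s = H s) → (∀ s, (H s).IsSymm) →
        ∀ (sstar : S), (H sstar).mulVec θ₀ = θ₀ → 1 ≤ (H sstar).trace →
        ∀ (sh : (Fin n → ℝ) → S), Measurable sh →
        (∀ y, SUREf σ H (sh y) y = ⨅ s, SUREf σ H s y) →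
        edf n σ θ₀ H sh
          ≤ C * (Real.sqrt ((H sstar).trace * Real.log (Fintype.card S))
             + Real.log (Fintype.card S)
               * (1 + max 0 (Real.log
                    (Real.log (Fintype.card S) / (H sstar).trace)))) := by
  refine ⟨8, by norm_num, ?_⟩
  intro n σ hσ θ₀ S _ _ _ _ H hH hs sstar hθ hp sh hsh hmin
  set L := Real.log (Fintype.card S)
  have hL : 0 ≤ L := Real.log_natCast_nonneg _
  have hη : H sstar *ᵥ (σ⁻¹ • θ₀) = σ⁻¹ • θ₀ := by rw [mulVec_smul, hθ]
  have hsel : ∀ x : Fin n → ℝ,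
      projRisk (H (sh (θ₀ + σ • x))) (σ⁻¹ • θ₀) -
        projNoise (H (sh (θ₀ + σ • x))) (σ⁻¹ • θ₀) 2 x ≤
      projRisk (H sstar) (σ⁻¹ • θ₀) - projNoise (H sstar) (σ⁻¹ • θ₀) 2 x := fun x => by
    have h := (hmin (θ₀ + σ • x)).trans_le (ciInf_le (Set.finite_range _).bddBelow sstar)
    rw [SUREf_add_smul hσ _ _ (hH _) (hs _), SUREf_add_smul hσ _ _ (hH _) (hs _)] at h
    have := le_of_mul_le_mul_left h (by positivity)
    linarith
  rw [edf_eq_integral_projNoise hσ θ₀ H hsh]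
  refine (integral_selected_projNoise_le hH hs (hsh.comp (by fun_prop)) hη (by linarith)
    hsel).trans ?_
  gcongr
  exact le_mul_of_one_le_right hL (le_add_of_nonneg_right (le_max_left _ _))
end
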